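/- Consider the planar system (P'): v' = μv − ωw + f(v,w) + f_q(v,w) + f_c(v,w), w' = ωv + μw + g(v,w) + g_q(v,w) + g_c(v,w), and assume σ_# ≠ 0. Then there exist ε, δ, C > 0 such that for every μ with 0 < |μ| < ε: (i) if μ·σ_# < 0, the system (P') has a nonconstant periodic solution (v,w) : ℝ → ℝ² with 0 < sup_t √(v(t)² + w(t)²) < δ and |sup_t √(v(t)² + w(t)²) + 3πμ/(2σ_#)| ≤ C·μ²; any two nonconstant periodic solutions with supremum norm less than δ coincide up to a time translation; (ii) if μ·σ_# > 0, there is no nonconstant periodic solution with supremum norm less than δ. In particular, the smooth quadratic terms f_q, g_q and the cubic terms f_c, g_c do not affect σ_# or the leading-order bifurcation. -/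

import Mathlib

open Real Set

/-- A (global) solution of the autonomous planar ODE `u' = F(u)`. -/
def IsSolution2 (F : ℝ × ℝ → ℝ × ℝ) (u : ℝ → ℝ × ℝ) : Prop :=
  ∀ t, HasDerivAt u (F (u t)) t

/-- A nonconstant periodic solution of `u' = F(u)`. -/
def IsPeriodicSolution2 (F : ℝ × ℝ → ℝ × ℝ) (u : ℝ → ℝ × ℝ) : Prop :=
  IsSolution2 F u ∧ (∃ T > 0, ∀ t, u (t + T) = u t) ∧ ¬ (∀ t, u t = u 0)

/-- The amplitude `sup_t √(v(t)² + w(t)²)` of a planar curve. -/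
noncomputable def ampl2 (u : ℝ → ℝ × ℝ) : ℝ :=
  ⨆ t : ℝ, Real.sqrt ((u t).1 ^ 2 + (u t).2 ^ 2)

structure PolarData where
  ω : ℝ
  m : ℝ
  B : ℝ
  X2 : ℝ → ℝ
  X3 : ℝ → ℝ
  O2 : ℝ → ℝ
  O3 : ℝ → ℝ
  Xi : ℝ → ℝ
  hω : 0 < ω
  hm : m ≠ 0
  hB : 1 ≤ B
  cX2 : Continuous X2
  cX3 : Continuous X3
  cO2 : Continuous O2
  cO3 : Continuous O3
  bX2 : ∀ θ, |X2 θ| ≤ B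
  bX3 : ∀ θ, |X3 θ| ≤ B
  bO2 : ∀ θ, |O2 θ| ≤ B
  bO3 : ∀ θ, |O3 θ| ≤ B
  pX2 : ∀ θ, X2 (θ + 2 * π) = X2 θ
  pX3 : ∀ θ, X3 (θ + 2 * π) = X3 θ
  pO2 : ∀ θ, O2 (θ + 2 * π) = O2 θ
  pO3 : ∀ θ, O3 (θ + 2 * π) = O3 θ
  dXi : ∀ θ, HasDerivAt Xi (X2 θ) θ
  pXi : ∀ θ, Xi (θ + 2 * π) = Xi θ + m

namespace PolarData

/-- logarithmic radial rate -/
noncomputable def rad (P : PolarData) (μ θ r : ℝ) : ℝ := μ + r * P.X2 θ + r ^ 2 * P.X3 θ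
/-- angular rate -/
noncomputable def ang (P : PolarData) (θ r : ℝ) : ℝ := P.ω + r * P.O2 θ + r ^ 2 * P.O3 θ
noncomputable def G (P : PolarData) (μ θ r : ℝ) : ℝ := P.rad μ θ r / P.ang θ r

noncomputable def d0 (P : PolarData) : ℝ := min 1 (P.ω / (4 * P.B))

lemma d0_pos (P : PolarData) : 0 < P.d0 := by
  have := P.hω; have := P.hB
  unfold d0; positivity

lemma d0_le_one (P : PolarData) : P.d0 ≤ 1 := min_le_left _ _

lemma ang_near (P : PolarData) {θ r : ℝ} (h0 : 0 ≤ r) (h1 : r ≤ P.d0) :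
    |P.ang θ r - P.ω| ≤ P.ω / 2 := by
  have hω := P.hω
  have hB := P.hB
  have h2 : r ≤ 1 := h1.trans (min_le_left _ _)
  have h3 : r ≤ P.ω / (4 * P.B) := h1.trans (min_le_right _ _)
  rw [le_div_iff₀ (by positivity)] at h3
  have e : P.ang θ r - P.ω = r * P.O2 θ + r ^ 2 * P.O3 θ := by unfold ang; ring
  rw [e]
  calc |r * P.O2 θ + r ^ 2 * P.O3 θ| ≤ |r * P.O2 θ| + |r ^ 2 * P.O3 θ| := abs_add_le _ _
    _ = r * |P.O2 θ| + r ^ 2 * |P.O3 θ| := by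
        rw [abs_mul, abs_mul, abs_of_nonneg h0, abs_of_nonneg (sq_nonneg r)]
    _ ≤ r * P.B + r * P.B := by
        have : r ^ 2 ≤ r := by nlinarith
        have := P.bO2 θ
        have := P.bO3 θ
        gcongr
    _ ≤ _ := by linarith

lemma ang_ge (P : PolarData) {θ r : ℝ} (h0 : 0 ≤ r) (h1 : r ≤ P.d0) :
    P.ω / 2 ≤ P.ang θ r := by
  have := (abs_le.1 (P.ang_near (θ := θ) h0 h1)).1
  linarith

lemma ang_pos (P : PolarData) {θ r : ℝ} (h0 : 0 ≤ r) (h1 : r ≤ P.d0) :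
    0 < P.ang θ r := lt_of_lt_of_le (half_pos P.hω) (P.ang_ge h0 h1)

lemma G_zero (P : PolarData) (μ θ : ℝ) : P.G μ θ 0 = μ / P.ω := by
  simp [G, rad, ang]

lemma G_est (P : PolarData) : ∃ K > 0, ∀ μ d θ r1 r2 : ℝ, |μ| ≤ 1 → d ≤ P.d0 → 0 ≤ r1 →
    0 ≤ r2 → r1 ≤ d → r2 ≤ d →
    |P.G μ θ r2 - P.G μ θ r1 - P.X2 θ * (r2 - r1) / P.ω| ≤ K * (d + |μ|) * |r2 - r1| := by
  have hω := P.hω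
  have hB := P.hB
  set ω := P.ω with hωd
  set B := P.B with hBd
  set Ka : ℝ := ω * B + 2 * B + 2 * B ^ 2 with hKa
  set Kb : ℝ := ω * B + B + 3 * B ^ 2 with hKb
  have hKap : 0 < Ka := by positivity
  have hKbp : 0 < Kb := by positivity
  refine ⟨(Ka * (2 / ω) + (Kb * (2 / ω) + Ka * 2 * (3 * B) * (2 / ω * (2 / ω)))) / ω,
    by positivity, ?_⟩
  intro μ d θ r1 r2 hμ hd h1 h2 h1d h2d
  have hd1 : d ≤ 1 := hd.trans P.d0_le_one
  have hd0 : 0 ≤ d := h1.trans h1d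
  have hx2 := P.bX2 θ
  have hx3 := P.bX3 θ
  have ho2 := P.bO2 θ
  have ho3 := P.bO3 θ
  set x2 := P.X2 θ
  set x3 := P.X3 θ
  set o2 := P.O2 θ
  set o3 := P.O3 θ
  have a1 : ω / 2 ≤ P.ang θ r1 := P.ang_ge h1 (h1d.trans hd)
  have a2 : ω / 2 ≤ P.ang θ r2 := P.ang_ge h2 (h2d.trans hd)
  set e1 := P.ang θ r1 with he1
  set e2 := P.ang θ r2 with he2
  have e1p : 0 < e1 := lt_of_lt_of_le (half_pos hω) a1
  have e2p : 0 < e2 := lt_of_lt_of_le (half_pos hω) a2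
  have i1 : e1⁻¹ ≤ 2 / ω := by
    rw [inv_le_comm₀ e1p (by positivity)]; rw [inv_div]; exact a1
  have i2 : e2⁻¹ ≤ 2 / ω := by
    rw [inv_le_comm₀ e2p (by positivity)]; rw [inv_div]; exact a2
  let N : ℝ → ℝ := fun r => ω * r * x3 - (μ + x2 * r) * (o2 + r * o3)
  have hN : ∀ r, 0 ≤ r → r ≤ d → |N r| ≤ Ka * (d + |μ|) := by
    intro r hr0 hrd
    have hr : |r| ≤ d := by rwa [abs_of_nonneg hr0]
    calc |N r| ≤ |ω * r * x3| + |(μ + x2 * r) * (o2 + r * o3)| := abs_sub _ _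
      _ ≤ ω * d * B + (|μ| + B * d) * (B + 1 * B) := by
          rw [abs_mul, abs_mul, abs_mul, abs_of_pos hω]
          have q1 : |μ + x2 * r| ≤ |μ| + B * d := by
            refine (abs_add_le _ _).trans ?_
            rw [abs_mul]; gcongr
          have q2 : |o2 + r * o3| ≤ B + 1 * B := by
            refine (abs_add_le _ _).trans ?_
            rw [abs_mul]
            have : |r| ≤ 1 := hr.trans hd1
            gcongr
          gcongr
      _ ≤ Ka * (d + |μ|) := by
          have := abs_nonneg μ
          rw [hKa]
          have : 0 ≤ ω * B * |μ| := by positivity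
          have : 0 ≤ B * d := by positivity
          have : 0 ≤ B ^ 2 * |μ| := by positivity
          nlinarith
  have hNd : |N r2 - N r1| ≤ Kb * |r2 - r1| := by
    have e : N r2 - N r1 = (ω * x3 - μ * o3 - x2 * o2 - x2 * o3 * (r1 + r2)) * (r2 - r1) := by
      simp only [N]; ring
    rw [e, abs_mul]
    gcongr
    have s : |r1 + r2| ≤ 2 := by rw [abs_of_nonneg (by linarith)]; linarith
    calc |ω * x3 - μ * o3 - x2 * o2 - x2 * o3 * (r1 + r2)|
        ≤ |ω * x3| + |μ * o3| + |x2 * o2| + |x2 * o3 * (r1 + r2)| := by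
          refine (abs_sub _ _).trans ?_
          gcongr
          refine (abs_sub _ _).trans ?_
          gcongr
          exact abs_sub _ _
      _ ≤ ω * B + 1 * B + B * B + B * B * 2 := by
          simp only [abs_mul, abs_of_pos hω]
          gcongr
      _ = Kb := by rw [hKb]; ring
  have hed : |e1 - e2| ≤ 3 * B * |r2 - r1| := by
    have e : e1 - e2 = - (o2 + (r1 + r2) * o3) * (r2 - r1) := by
      simp only [he1, he2, ang]; ring
    rw [e, abs_mul, abs_neg]
    gcongr
    have s : |r1 + r2| ≤ 2 := by rw [abs_of_nonneg (by linarith)]; linarith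
    calc |o2 + (r1 + r2) * o3| ≤ |o2| + |(r1 + r2) * o3| := abs_add_le _ _
      _ ≤ B + 2 * B := by rw [abs_mul]; gcongr
      _ = 3 * B := by ring
  have key : P.G μ θ r2 - P.G μ θ r1 - x2 * (r2 - r1) / ω =
      ((r2 - r1) * (N r2 * e2⁻¹) + r1 * ((N r2 - N r1) * e2⁻¹ +
        N r1 * (e1 - e2) * (e1⁻¹ * e2⁻¹))) / ω := by
    have g : ∀ r, P.ang θ r ≠ 0 → P.G μ θ r = μ / ω + x2 * r / ω + r * N r * (P.ang θ r)⁻¹ / ω := by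
      intro r hr
      have : P.G μ θ r = P.rad μ θ r / P.ang θ r := rfl
      rw [this]
      field_simp
      simp only [rad, ang, N]
      ring
    rw [g r2 e2p.ne', g r1 e1p.ne', ← he1, ← he2]
    field_simp
    ring
  rw [key, abs_div, abs_of_pos hω, div_le_iff₀ hω]
  have hη : d + |μ| ≤ 2 := by linarith
  have hη0 : 0 ≤ d + |μ| := by positivity
  calc _ ≤ |r2 - r1| * (|N r2| * e2⁻¹) + r1 * (|N r2 - N r1| * e2⁻¹ +
        |N r1| * |e1 - e2| * (e1⁻¹ * e2⁻¹)) := by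
        refine (abs_add_le _ _).trans ?_
        rw [abs_mul, abs_mul, abs_mul, abs_of_nonneg h1, abs_of_pos (inv_pos.2 e2p)]
        gcongr
        refine (abs_add_le _ _).trans ?_
        rw [abs_mul, abs_mul, abs_mul, abs_mul, abs_of_pos (inv_pos.2 e2p),
          abs_of_pos (inv_pos.2 e1p)]
    _ ≤ |r2 - r1| * (Ka * (d + |μ|) * (2 / ω)) + (d + |μ|) * (Kb * |r2 - r1| * (2 / ω) +
        Ka * 2 * (3 * B * |r2 - r1|) * (2 / ω * (2 / ω))) := by
        have n1 := hN r1 h1 h1d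
        have n2 := hN r2 h2 h2d
        have n3 : |N r1| ≤ Ka * 2 := n1.trans (by gcongr)
        have : r1 ≤ d + |μ| := by have := abs_nonneg μ; linarith
        gcongr
    _ = _ := by field_simp

lemma near_const {y y' : ℝ → ℝ} {a k : ℝ} (hk : 0 ≤ k)
    (hy : ∀ t ∈ Icc a (a + 2 * π), HasDerivWithinAt y (y' t) (Icc a (a + 2 * π)) t)
    (hb : ∀ t ∈ Icc a (a + 2 * π), |y' t| ≤ k * |y t|) :
    ∀ t ∈ Icc a (a + 2 * π), |y t - y a| ≤ k * (rexp (k * (2 * π)) * (2 * π)) * |y a| ∧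
      |y t| ≤ rexp (k * (2 * π)) * |y a| := by
  have hpi := Real.pi_pos
  have g : ∀ t ∈ Icc a (a + 2 * π), |y t| ≤ rexp (k * (2 * π)) * |y a| := by
    intro t ht
    have := norm_le_gronwallBound_of_norm_deriv_right_le (f := y) (f' := y') (δ := |y a|) (K := k)
      (ε := 0) (a := a) (b := a + 2 * π) (fun t ht => (hy t ht).continuousWithinAt)
      (fun t ht => (hy t (Ico_subset_Icc_self ht)).mono_of_mem_nhdsWithin
        (Icc_mem_nhdsGE_of_mem ht)) le_rfl
      (fun t ht => by simpa using hb t (Ico_subset_Icc_self ht)) t ht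
    rw [gronwallBound_ε0] at this
    rw [mul_comm]
    refine this.trans ?_
    have : t - a ≤ 2 * π := by linarith [ht.2]
    gcongr
  intro t ht
  refine ⟨?_, g t ht⟩
  have := norm_image_sub_le_of_norm_deriv_le_segment' (f := y) (f' := y')
    (C := k * (rexp (k * (2 * π)) * |y a|)) hy
    (fun t ht => by
      refine (hb t (Ico_subset_Icc_self ht)).trans ?_
      gcongr
      exact g t (Ico_subset_Icc_self ht)) t ht
  refine this.trans ?_
  have : t - a ≤ 2 * π := by linarith [ht.2]
  calc _ ≤ k * (rexp (k * (2 * π)) * |y a|) * (2 * π) := by gcongr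
    _ = _ := by ring

/-- The main averaging estimate. -/
lemma disp (P : PolarData) : ∃ K > 0, ∀ μ d a : ℝ, ∀ ρ1 ρ2 J : ℝ → ℝ, |μ| ≤ 1 → d ≤ P.d0 →
    (∀ t ∈ Icc a (a + 2 * π), 0 ≤ ρ1 t ∧ ρ1 t ≤ d ∧ 0 ≤ ρ2 t ∧ ρ2 t ≤ d) →
    (∀ t ∈ Icc a (a + 2 * π),
      HasDerivWithinAt ρ1 (ρ1 t * P.G μ t (ρ1 t)) (Icc a (a + 2 * π)) t) →
    (∀ t ∈ Icc a (a + 2 * π),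
      HasDerivWithinAt ρ2 (ρ2 t * P.G μ t (ρ2 t)) (Icc a (a + 2 * π)) t) →
    (∀ t ∈ Icc a (a + 2 * π),
      HasDerivWithinAt J (P.G μ t (ρ2 t) - P.G μ t (ρ1 t)) (Icc a (a + 2 * π)) t) →
    |J (a + 2 * π) - J a - P.m / P.ω * (ρ2 a - ρ1 a)| ≤ K * (d + |μ|) * |ρ2 a - ρ1 a| ∧
    ∀ t ∈ Icc a (a + 2 * π),
      |(ρ2 t - ρ1 t) - (ρ2 a - ρ1 a)| ≤ K * (d + |μ|) * |ρ2 a - ρ1 a| := by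
  obtain ⟨K, hK, hG⟩ := P.G_est
  have hω := P.hω
  have hB := P.hB
  have hpi := Real.pi_pos
  -- Lipschitz constant of G
  set Lc : ℝ := K * 2 + P.B / P.ω with hLc
  set M : ℝ := 1 / P.ω + Lc with hM
  have hLcp : 0 < Lc := by positivity
  have hMp : 0 < M := by positivity
  have hLip : ∀ μ d θ r1 r2 : ℝ, |μ| ≤ 1 → d ≤ P.d0 → 0 ≤ r1 →
    0 ≤ r2 → r1 ≤ d → r2 ≤ d → |P.G μ θ r2 - P.G μ θ r1| ≤ Lc * |r2 - r1| := by
    intro μ d θ r1 r2 hμ hd h1 h2 h1d h2d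
    have := hG μ d θ r1 r2 hμ hd h1 h2 h1d h2d
    have h3 : |P.X2 θ * (r2 - r1) / P.ω| ≤ P.B / P.ω * |r2 - r1| := by
      rw [abs_div, abs_mul, abs_of_pos hω, mul_div_right_comm]
      have := P.bX2 θ
      gcongr
    have h4 : K * (d + |μ|) * |r2 - r1| ≤ K * 2 * |r2 - r1| := by
      have := hd.trans P.d0_le_one
      gcongr; linarith
    have := abs_add_le (P.G μ θ r2 - P.G μ θ r1 - P.X2 θ * (r2 - r1) / P.ω)
      (P.X2 θ * (r2 - r1) / P.ω)
    rw [sub_add_cancel] at this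
    rw [hLc]; linarith
  have hGb : ∀ μ d θ r : ℝ, |μ| ≤ 1 → d ≤ P.d0 → 0 ≤ r → r ≤ d →
      |P.G μ θ r| ≤ M * (d + |μ|) := by
    intro μ d θ r hμ hd h1 h1d
    have := hLip μ d θ 0 r hμ hd le_rfl h1 (h1.trans h1d) h1d
    rw [P.G_zero, sub_zero, abs_of_nonneg h1] at this
    have h2 := abs_add_le (P.G μ θ r - μ / P.ω) (μ / P.ω)
    rw [sub_add_cancel, abs_div, abs_of_pos hω] at h2
    have h3 : 0 ≤ Lc * |μ| := by positivity
    have h4 : Lc * r ≤ Lc * d := by gcongr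
    have h5 : 0 ≤ 1 / P.ω * d := mul_nonneg (by positivity) (h1.trans h1d)
    have h6 : |μ| / P.ω = 1 / P.ω * |μ| := by ring
    rw [hM]; nlinarith
  set Q : ℝ := M + Lc with hQ
  have hQp : 0 < Q := by positivity
  set E : ℝ := rexp (Q * 2 * (2 * π)) with hE
  have hEp : 0 < E := Real.exp_pos _
  set K1 : ℝ := Q * (E * (2 * π)) with hK1
  have hK1p : 0 < K1 := by positivity
  set K2 : ℝ := (P.B / P.ω * K1 + K * E) * (2 * π) with hK2
  have hK2p : 0 < K2 := by positivity
  refine ⟨K1 + K2, by positivity, ?_⟩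
  intro μ d a ρ1 ρ2 J hμ hd hr h1 h2 hJ
  have haI : a ∈ Icc a (a + 2 * π) := ⟨le_rfl, by linarith⟩
  have hd00 : 0 ≤ d := (hr a haI).1.trans (hr a haI).2.1
  have hη0 : 0 ≤ d + |μ| := by positivity
  have hη2 : d + |μ| ≤ 2 := by have := hd.trans P.d0_le_one; linarith
  have nc := near_const (y := fun t => ρ2 t - ρ1 t) (a := a) (k := Q * (d + |μ|))
    (by positivity) (fun t ht => (h2 t ht).sub (h1 t ht)) (by
      intro t ht
      obtain ⟨p1, p2, p3, p4⟩ := hr t ht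
      have e : ρ2 t * P.G μ t (ρ2 t) - ρ1 t * P.G μ t (ρ1 t) =
        (ρ2 t - ρ1 t) * P.G μ t (ρ2 t) + ρ1 t * (P.G μ t (ρ2 t) - P.G μ t (ρ1 t)) := by ring
      rw [e]
      refine (abs_add_le _ _).trans ?_
      rw [abs_mul, abs_mul, abs_of_nonneg p1]
      have q1 := hGb μ d t _ hμ hd p3 p4
      have q2 := hLip μ d t _ _ hμ hd p1 p3 p2 p4
      have q3 : ρ1 t ≤ d + |μ| := by have := abs_nonneg μ; linarith
      calc _ ≤ |ρ2 t - ρ1 t| * (M * (d + |μ|)) + (d + |μ|) * (Lc * |ρ2 t - ρ1 t|) := by gcongr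
        _ = _ := by rw [hQ]; ring)
  have hexp : rexp (Q * (d + |μ|) * (2 * π)) ≤ E := by
    rw [hE]; gcongr
  have nc1 : ∀ t ∈ Icc a (a + 2 * π),
      |(ρ2 t - ρ1 t) - (ρ2 a - ρ1 a)| ≤ K1 * (d + |μ|) * |ρ2 a - ρ1 a| := by
    intro t ht
    refine (nc t ht).1.trans ?_
    calc _ ≤ Q * (d + |μ|) * (E * (2 * π)) * |ρ2 a - ρ1 a| := by gcongr
      _ = _ := by rw [hK1]; ring
  have nc2 : ∀ t ∈ Icc a (a + 2 * π), |ρ2 t - ρ1 t| ≤ E * |ρ2 a - ρ1 a| := by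
    intro t ht
    refine (nc t ht).2.trans ?_
    gcongr
  constructor
  · have mv := norm_image_sub_le_of_norm_deriv_le_segment'
      (f := fun t => J t - (ρ2 a - ρ1 a) / P.ω * P.Xi t)
      (C := (P.B / P.ω * K1 + K * E) * (d + |μ|) * |ρ2 a - ρ1 a|)
      (fun t ht => (hJ t ht).sub (((P.dXi t).hasDerivWithinAt).const_mul _))
      (fun t ht => by
        have ht := Ico_subset_Icc_self ht
        obtain ⟨p1, p2, p3, p4⟩ := hr t ht
        have e : P.G μ t (ρ2 t) - P.G μ t (ρ1 t) - (ρ2 a - ρ1 a) / P.ω * P.X2 t =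
          (P.G μ t (ρ2 t) - P.G μ t (ρ1 t) - P.X2 t * (ρ2 t - ρ1 t) / P.ω) +
          P.X2 t / P.ω * ((ρ2 t - ρ1 t) - (ρ2 a - ρ1 a)) := by field_simp; ring
        rw [e, Real.norm_eq_abs]
        refine (abs_add_le _ _).trans ?_
        have q1 := hG μ d t _ _ hμ hd p1 p3 p2 p4
        have q2 := nc1 t ht
        have q3 := nc2 t ht
        have q4 := P.bX2 t
        rw [abs_mul, abs_div, abs_of_pos hω]
        calc _ ≤ K * (d + |μ|) * (E * |ρ2 a - ρ1 a|) +
              P.B / P.ω * (K1 * (d + |μ|) * |ρ2 a - ρ1 a|) := by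
              refine add_le_add (q1.trans ?_) ?_ <;> gcongr
          _ = _ := by ring) (a + 2 * π) ⟨by linarith, le_rfl⟩
    rw [Real.norm_eq_abs, P.pXi] at mv
    have e : J (a + 2 * π) - (ρ2 a - ρ1 a) / P.ω * (P.Xi a + P.m) -
      (J a - (ρ2 a - ρ1 a) / P.ω * P.Xi a) = J (a + 2 * π) - J a - P.m / P.ω * (ρ2 a - ρ1 a) := by
      field_simp; ring
    rw [e] at mv
    refine mv.trans ?_
    have : 0 ≤ K1 * (d + |μ|) * |ρ2 a - ρ1 a| := by positivity
    rw [hK2]; linarith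
  · intro t ht
    refine (nc1 t ht).trans ?_
    gcongr; linarith

end PolarData

namespace PolarData

/-- inverse of a function with derivative bounded below -/
lemma exists_inverse {φ h : ℝ → ℝ} {c : ℝ} (hc : 0 < c) (hφ : ∀ t, HasDerivAt φ (h t) t)
    (hh : ∀ t, c ≤ h t) : ∃ ψ : ℝ → ℝ, (∀ t, ψ (φ t) = t) ∧ (∀ s, φ (ψ s) = s) ∧
      ∀ s, HasDerivAt ψ (h (ψ s))⁻¹ s := by
  have hmono : StrictMono φ := strictMono_of_deriv_pos (fun t => by
    rw [(hφ t).deriv]; exact lt_of_lt_of_le hc (hh t))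
  have hcont : Continuous φ := continuous_iff_continuousAt.2 (fun t => (hφ t).continuousAt)
  have hlin : Monotone (fun t => φ t - c * t) := by
    apply monotone_of_deriv_nonneg
    · exact fun t => ((hφ t).sub ((hasDerivAt_id t).const_mul c)).differentiableAt
    · intro t
      have := ((hφ t).sub ((hasDerivAt_id t).const_mul c)).deriv
      simp only [id] at this
      change 0 ≤ deriv (φ - fun y => c * y) t
      rw [this]; have := hh t; linarith
  have hsurj : Function.Surjective φ := by
    intro s
    have hd := abs_nonneg (s - φ 0)
    have e : c * (|s - φ 0| / c) = |s - φ 0| := by field_simp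
    have h1 : s ≤ φ (|s - φ 0| / c) := by
      have := hlin (show (0:ℝ) ≤ |s - φ 0| / c by positivity)
      simp only [mul_zero, sub_zero, e] at this
      have := le_abs_self (s - φ 0)
      linarith
    have h2 : φ (-(|s - φ 0| / c)) ≤ s := by
      have := hlin (show -(|s - φ 0| / c) ≤ (0:ℝ) by have : 0 ≤ |s - φ 0| / c := by positivity
                                                     linarith)
      simp only [mul_zero, sub_zero, mul_neg, e] at this
      have := neg_abs_le (s - φ 0)
      linarith
    have : s ∈ Icc (φ (-(|s - φ 0| / c))) (φ (|s - φ 0| / c)) := ⟨h2, h1⟩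
    have := intermediate_value_univ (-(|s - φ 0| / c)) (|s - φ 0| / c) hcont this
    exact this
  let e := StrictMono.orderIsoOfSurjective φ hmono hsurj
  have he : ∀ t, e t = φ t := fun t => rfl
  refine ⟨e.symm, fun t => ?_, fun s => ?_, fun s => ?_⟩
  · rw [← he]; simp
  · rw [← he]; simp
  · refine HasDerivAt.of_local_left_inverse (f := φ) e.symm.continuous.continuousAt (hφ _)
      (lt_of_lt_of_le hc (hh _)).ne' (Filter.Eventually.of_forall fun s => ?_)
    rw [← he]; simp

/-- `F` has the polar form given by `P`. -/
def Rep (P : PolarData) (μ : ℝ) (F : ℝ × ℝ → ℝ × ℝ) : Prop :=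
  ∀ r θ : ℝ, 0 ≤ r → F (r * cos θ, r * sin θ) =
    (r * P.rad μ θ r * cos θ - r * P.ang θ r * sin θ,
     r * P.rad μ θ r * sin θ + r * P.ang θ r * cos θ)

lemma exists_polar (p : ℝ × ℝ) : ∃ r θ : ℝ, 0 ≤ r ∧ p = (r * cos θ, r * sin θ) ∧
    r = √(p.1 ^ 2 + p.2 ^ 2) := by
  refine ⟨‖(⟨p.1, p.2⟩ : ℂ)‖, Complex.arg ⟨p.1, p.2⟩, norm_nonneg _, ?_, ?_⟩
  · ext
    · simp
    · simp
  · rw [Complex.norm_eq_sqrt_sq_add_sq]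

lemma zero_of_zero {N N' : ℝ → ℝ} {K t0 : ℝ} (hN : ∀ t, HasDerivAt N (N' t) t)
    (h0 : ∀ t, 0 ≤ N t) (hb : ∀ t, |N' t| ≤ K * N t) (ht0 : N t0 = 0) : ∀ t, N t = 0 := by
  have d : ∀ (k t : ℝ), HasDerivAt (fun t => N t * rexp (k * t))
      (N' t * rexp (k * t) + N t * (rexp (k * t) * (k * 1))) t := fun k t =>
    (hN t).mul (((hasDerivAt_id t).const_mul k).exp)
  have m1 : Monotone (fun t => N t * rexp (K * t)) := by
    apply monotone_of_deriv_nonneg (fun t => (d K t).differentiableAt)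
    intro t
    rw [(d K t).deriv]
    have := (abs_le.1 (hb t)).1
    have := Real.exp_pos (K * t)
    nlinarith
  have m2 : Antitone (fun t => N t * rexp (-K * t)) := by
    apply antitone_of_deriv_nonpos (fun t => (d (-K) t).differentiableAt)
    intro t
    rw [(d (-K) t).deriv]
    have := (abs_le.1 (hb t)).2
    have := Real.exp_pos (-K * t)
    nlinarith
  intro t
  refine le_antisymm ?_ (h0 t)
  rcases le_total t t0 with h | h
  · have := m1 h
    simp only [ht0, zero_mul] at this
    exact nonpos_of_mul_nonpos_left this (Real.exp_pos _)
  · have := m2 h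
    simp only [ht0, zero_mul] at this
    exact nonpos_of_mul_nonpos_left this (Real.exp_pos _)

lemma rad_bound (P : PolarData) {μ θ r : ℝ} (hμ : |μ| ≤ 1) (h0 : 0 ≤ r) (h1 : r ≤ P.d0) :
    |P.rad μ θ r| ≤ 1 + 2 * P.B := by
  have hB := P.hB
  have h2 := h1.trans P.d0_le_one
  unfold rad
  have q1 := P.bX2 θ
  have q2 := P.bX3 θ
  have h3 : r ^ 2 ≤ 1 := by nlinarith
  calc _ ≤ |μ| + |r * P.X2 θ| + |r ^ 2 * P.X3 θ| := abs_add_three _ _ _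
    _ = |μ| + r * |P.X2 θ| + r ^ 2 * |P.X3 θ| := by
      rw [abs_mul, abs_mul, abs_of_nonneg h0, abs_of_nonneg (sq_nonneg r)]
    _ ≤ 1 + 1 * P.B + 1 * P.B := by gcongr
    _ = _ := by ring

/-- A polar description of a nonconstant small periodic solution. -/
lemma polar_of_sol (P : PolarData) {μ d T : ℝ} {F : ℝ × ℝ → ℝ × ℝ} (hμ : |μ| ≤ 1)
    (hF : P.Rep μ F) (hFc : Continuous F) (hd : d ≤ P.d0) {u : ℝ → ℝ × ℝ} (hu : ∀ t, HasDerivAt u (F (u t)) t)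
    (hT : 0 < T) (hper : ∀ t, u (t + T) = u t) (hnc : ¬ ∀ t, u t = u 0)
    (hsm : ∀ t, √((u t).1 ^ 2 + (u t).2 ^ 2) < d) :
    ∃ (φ ψ ρ : ℝ → ℝ) (n : ℕ), (∀ t, ψ (φ t) = t) ∧ (∀ s, φ (ψ s) = s) ∧
      (∀ t, u t = (ρ (φ t) * cos (φ t), ρ (φ t) * sin (φ t))) ∧
      (∀ s, 0 < ρ s ∧ ρ s < d) ∧
      (∀ s, HasDerivAt ρ (ρ s * P.G μ s (ρ s)) s) ∧
      (∀ s, HasDerivAt ψ (P.ang s (ρ s))⁻¹ s) ∧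
      (∀ s, ρ (s + (n + 1 : ℕ) * (2 * π)) = ρ s) := by
  have hpi := Real.pi_pos
  set v : ℝ → ℝ := fun t => (u t).1 with hv
  set w : ℝ → ℝ := fun t => (u t).2 with hw
  set v' : ℝ → ℝ := fun t => (F (u t)).1 with hv'
  set w' : ℝ → ℝ := fun t => (F (u t)).2 with hw'
  have dv : ∀ t, HasDerivAt v (v' t) t := fun t => (hu t).fst
  have dw : ∀ t, HasDerivAt w (w' t) t := fun t => (hu t).snd
  -- pointwise polar information
  have pol : ∀ t, ∃ r θ : ℝ, 0 ≤ r ∧ r < d ∧ v t = r * cos θ ∧ w t = r * sin θ ∧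
      v' t = r * P.rad μ θ r * cos θ - r * P.ang θ r * sin θ ∧
      w' t = r * P.rad μ θ r * sin θ + r * P.ang θ r * cos θ := by
    intro t
    obtain ⟨r, θ, h0, h1, h2⟩ := exists_polar (u t)
    refine ⟨r, θ, h0, h2 ▸ hsm t, ?_, ?_, ?_, ?_⟩
    · simp only [hv]; rw [h1]
    · simp only [hw]; rw [h1]
    · simp only [hv']; rw [h1, hF r θ h0]
    · simp only [hw']; rw [h1, hF r θ h0]
  set N : ℝ → ℝ := fun t => v t ^ 2 + w t ^ 2 with hN
  have dN : ∀ t, HasDerivAt N (2 * v t * v' t + 2 * w t * w' t) t := by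
    intro t
    have := ((dv t).pow 2).add ((dw t).pow 2)
    simp only [Nat.cast_ofNat, Nat.reduceSub, pow_one] at this
    exact this
  have Npos : ∀ t, 0 < N t := by
    intro t
    rcases (show 0 ≤ N t by positivity).lt_or_eq with h | h
    · exact h
    · exfalso
      have z := zero_of_zero (K := 2 * (1 + 2 * P.B)) dN (fun t => by positivity) (by
        intro t
        obtain ⟨r, θ, h0, h1, e1, e2, e3, e4⟩ := pol t
        have sc := Real.sin_sq_add_cos_sq θ
        have e5 : N t = r ^ 2 := by simp only [hN, e1, e2]; linear_combination r ^ 2 * sc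
        have e6 : 2 * v t * v' t + 2 * w t * w' t = 2 * r ^ 2 * P.rad μ θ r := by
          rw [e1, e2, e3, e4]; linear_combination 2 * r ^ 2 * P.rad μ θ r * sc
        rw [e5, e6, abs_mul, abs_of_nonneg (show 0 ≤ 2 * r ^ 2 by positivity)]
        have := P.rad_bound (θ := θ) hμ h0 (h1.le.trans hd)
        nlinarith [sq_nonneg r]) h.symm
      have uz : ∀ t, u t = (0, 0) := by
        intro t
        have := z t
        have h1 : v t = 0 := by simp only [hN] at this; nlinarith [sq_nonneg (v t), sq_nonneg (w t)]
        have h2 : w t = 0 := by simp only [hN] at this; nlinarith [sq_nonneg (v t), sq_nonneg (w t)]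
        exact Prod.ext h1 h2
      exact hnc fun t => by rw [uz, uz]
  set A : ℝ → ℝ := fun t => (v t * v' t + w t * w' t) / N t with hA
  set Θ : ℝ → ℝ := fun t => (v t * w' t - w t * v' t) / N t with hΘ
  -- values of A, Θ for a given polar representation
  have val : ∀ t r θ, 0 < r → u t = (r * cos θ, r * sin θ) →
      A t = P.rad μ θ r ∧ Θ t = P.ang θ r ∧ N t = r ^ 2 := by
    intro t r θ hr h
    have sc := Real.sin_sq_add_cos_sq θ
    have e1 : v t = r * cos θ := by simp only [hv]; rw [h]
    have e2 : w t = r * sin θ := by simp only [hw]; rw [h]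
    have e3 : v' t = r * P.rad μ θ r * cos θ - r * P.ang θ r * sin θ := by
      simp only [hv']; rw [h, hF r θ hr.le]
    have e4 : w' t = r * P.rad μ θ r * sin θ + r * P.ang θ r * cos θ := by
      simp only [hw']; rw [h, hF r θ hr.le]
    have e5 : N t = r ^ 2 := by simp only [hN, e1, e2]; linear_combination r ^ 2 * sc
    refine ⟨?_, ?_, e5⟩
    · simp only [hA]; rw [e5, e1, e2, e3, e4, div_eq_iff (by positivity)]
      linear_combination r ^ 2 * P.rad μ θ r * sc
    · simp only [hΘ]; rw [e5, e1, e2, e3, e4, div_eq_iff (by positivity)]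
      linear_combination r ^ 2 * P.ang θ r * sc
  have cu : Continuous u := continuous_iff_continuousAt.2 fun t => (hu t).continuousAt
  have cFu : Continuous fun t => F (u t) := hFc.comp cu
  have cv : Continuous v := continuous_fst.comp cu
  have cw : Continuous w := continuous_snd.comp cu
  have cv' : Continuous v' := continuous_fst.comp cFu
  have cw' : Continuous w' := continuous_snd.comp cFu
  have cN : Continuous N := by fun_prop
  have cA : Continuous A :=
    ((cv.mul cv').add (cw.mul cw')).div cN fun t => (Npos t).ne'
  have cΘ : Continuous Θ :=
    ((cv.mul cw').sub (cw.mul cv')).div cN fun t => (Npos t).ne'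
  have ev : ∀ t, v' t = A t * v t - Θ t * w t := by
    intro t
    have := (Npos t).ne'
    simp only [hA, hΘ]
    field_simp
    simp only [hN]
    ring
  have ew : ∀ t, w' t = A t * w t + Θ t * v t := by
    intro t
    have := (Npos t).ne'
    simp only [hA, hΘ]
    field_simp
    simp only [hN]
    ring
  obtain ⟨r0, θ0, hr0, hu0, -⟩ := exists_polar (u 0)
  have hv0 : v 0 = r0 * cos θ0 := by simp only [hv]; rw [hu0]
  have hw0 : w 0 = r0 * sin θ0 := by simp only [hw]; rw [hu0]
  have hr0p : 0 < r0 := by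
    rcases hr0.lt_or_eq with h | h
    · exact h
    · exfalso
      have := Npos 0
      simp [hN, hv0, hw0, ← h] at this
  set z : ℝ → ℝ := fun t => Real.log r0 + ∫ s in (0:ℝ)..t, A s with hz
  set φ : ℝ → ℝ := fun t => θ0 + ∫ s in (0:ℝ)..t, Θ s with hφ
  have dz : ∀ t, HasDerivAt z (A t) t := fun t =>
    (cA.integral_hasStrictDerivAt 0 t).hasDerivAt.const_add _
  have dφ : ∀ t, HasDerivAt φ (Θ t) t := fun t =>
    (cΘ.integral_hasStrictDerivAt 0 t).hasDerivAt.const_add _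
  have z0 : rexp (-z 0) * r0 = 1 := by
    simp only [hz, intervalIntegral.integral_same, add_zero, Real.exp_neg, Real.exp_log hr0p]
    field_simp
  have φ0 : φ 0 = θ0 := by simp [hφ]
  have sc0 := Real.sin_sq_add_cos_sq θ0
  have hp : ∀ t, rexp (-z t) * (v t * cos (φ t) + w t * sin (φ t)) = 1 := by
    have dd : ∀ t, HasDerivAt (fun t => rexp (-z t) * (v t * cos (φ t) + w t * sin (φ t))) 0 t := by
      intro t
      have := ((dz t).neg.exp).mul (((dv t).mul (dφ t).cos).add ((dw t).mul (dφ t).sin))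
      refine this.congr_deriv ?_
      simp only [ev, ew, Pi.mul_apply, Pi.add_apply]
      ring
    intro t
    have := is_const_of_deriv_eq_zero (fun t => (dd t).differentiableAt) (fun t => (dd t).deriv) t 0
    rw [this, φ0, hv0, hw0]
    linear_combination sc0 * (rexp (-z 0) * r0) + z0
  have hq : ∀ t, rexp (-z t) * (w t * cos (φ t) - v t * sin (φ t)) = 0 := by
    have dd : ∀ t, HasDerivAt (fun t => rexp (-z t) * (w t * cos (φ t) - v t * sin (φ t))) 0 t := by
      intro t
      have := ((dz t).neg.exp).mul (((dw t).mul (dφ t).cos).sub ((dv t).mul (dφ t).sin))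
      refine this.congr_deriv ?_
      simp only [ev, ew, Pi.mul_apply, Pi.sub_apply]
      ring
    intro t
    have := is_const_of_deriv_eq_zero (fun t => (dd t).differentiableAt) (fun t => (dd t).deriv) t 0
    rw [this, φ0, hv0, hw0]
    ring
  have hup : ∀ t, u t = (rexp (z t) * cos (φ t), rexp (z t) * sin (φ t)) := by
    intro t
    have ez : rexp (z t) * rexp (-z t) = 1 := by rw [← Real.exp_add]; simp
    have sc := Real.sin_sq_add_cos_sq (φ t)
    have h1 := hp t
    have h2 := hq t
    refine Prod.ext ?_ ?_
    · change v t = rexp (z t) * cos (φ t)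
      linear_combination (-(v t) * sc) * (rexp (z t) * rexp (-z t)) - v t * ez
        + rexp (z t) * cos (φ t) * h1 - rexp (z t) * sin (φ t) * h2
    · change w t = rexp (z t) * sin (φ t)
      linear_combination (-(w t) * sc) * (rexp (z t) * rexp (-z t)) - w t * ez
        + rexp (z t) * sin (φ t) * h1 + rexp (z t) * cos (φ t) * h2
  have hzd : ∀ t, rexp (z t) < d := by
    intro t
    have h1 := hsm t
    have h2 := (val t _ _ (Real.exp_pos _) (hup t)).2.2
    simp only [hN, hv, hw] at h2
    rwa [h2, Real.sqrt_sq (Real.exp_pos _).le] at h1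
  have hAz : ∀ t, A t = P.rad μ (φ t) (rexp (z t)) := fun t =>
    (val t _ _ (Real.exp_pos _) (hup t)).1
  have hΘz : ∀ t, Θ t = P.ang (φ t) (rexp (z t)) := fun t =>
    (val t _ _ (Real.exp_pos _) (hup t)).2.1
  have hΘc : ∀ t, P.ω / 2 ≤ Θ t := fun t => by
    rw [hΘz]; exact P.ang_ge (Real.exp_pos _).le ((hzd t).le.trans hd)
  obtain ⟨ψ, i1, i2, dψ⟩ := exists_inverse (half_pos P.hω) dφ hΘc
  have hmono : StrictMono φ := strictMono_of_deriv_pos (fun t => by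
    rw [(dφ t).deriv]; exact lt_of_lt_of_le (half_pos P.hω) (hΘc t))
  -- periodicity
  have zper : ∀ t, z (t + T) = z t := by
    intro t
    have h1 := (val t _ _ (Real.exp_pos _) (hup t)).2.2
    have h2 := (val (t + T) _ _ (Real.exp_pos _) (hup (t + T))).2.2
    have h3 : N (t + T) = N t := by simp only [hN, hv, hw, hper]
    rw [h3, h1] at h2
    have := (pow_left_inj₀ (Real.exp_pos _).le (Real.exp_pos _).le two_ne_zero).1 h2
    exact (Real.exp_injective this).symm
  have Θper : ∀ t, Θ (t + T) = Θ t := by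
    intro t; simp only [hΘ, hN, hv, hw, hv', hw', hper]
  have φc : ∀ t, φ (t + T) - φ t = φ (0 + T) - φ 0 := by
    have dd : ∀ t, HasDerivAt (fun t => φ (t + T) - φ t) 0 t := by
      intro t
      have := ((dφ (t + T)).comp_add_const t T).sub (dφ t)
      rwa [Θper, sub_self] at this
    intro t
    exact is_const_of_deriv_eq_zero (fun t => (dd t).differentiableAt) (fun t => (dd t).deriv) t 0
  obtain ⟨n, hn⟩ : ∃ n : ℕ, φ (0 + T) - φ 0 = (n + 1 : ℕ) * (2 * π) := by
    have h1 := hup (0 + T)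
    rw [hper, hup 0, zper] at h1
    have c1 : cos (φ (0 + T)) = cos (φ 0) :=
      (mul_left_cancel₀ (Real.exp_pos _).ne' (congrArg Prod.fst h1)).symm
    have c2 : sin (φ (0 + T)) = sin (φ 0) :=
      (mul_left_cancel₀ (Real.exp_pos _).ne' (congrArg Prod.snd h1)).symm
    have c3 : cos (φ (0 + T) - φ 0) = 1 := by
      rw [Real.cos_sub, c1, c2]; have := Real.sin_sq_add_cos_sq (φ 0); linarith
    obtain ⟨k, hk⟩ := (Real.cos_eq_one_iff _).1 c3
    have hpos : 0 < φ (0 + T) - φ 0 := sub_pos.2 (hmono (by linarith))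
    rw [← hk] at hpos
    have hk0 : 0 < k := by
      have : (0:ℝ) < k := by
        by_contra hcon
        push Not at hcon
        nlinarith
      exact_mod_cast this
    obtain ⟨n, rfl⟩ : ∃ n : ℕ, k = (n + 1 : ℕ) := ⟨(k - 1).toNat, by omega⟩
    exact ⟨n, by rw [← hk]; push_cast; ring⟩
  refine ⟨φ, ψ, fun s => rexp (z (ψ s)), n, i1, i2, ?_, ?_, ?_, ?_, ?_⟩
  · intro t; simp only [i1]; exact hup t
  · intro s; exact ⟨Real.exp_pos _, hzd _⟩
  · intro s
    have := ((dz (ψ s)).comp s (dψ s)).exp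
    refine this.congr_deriv ?_
    rw [hAz, hΘz, i2]
    simp only [G, div_eq_mul_inv, Function.comp]
  · intro s
    have := dψ s
    rwa [hΘz, i2] at this
  · intro s
    have : ψ (s + (n + 1 : ℕ) * (2 * π)) = ψ s + T := by
      apply hmono.injective
      rw [i2]
      have := φc (ψ s)
      rw [i2, hn] at this
      linarith
    simp only [this, zper]

end PolarData

namespace PolarData

lemma grow {f : ℝ → ℝ} {Q : ℝ → Prop} {p : ℝ} (h : ∀ a, Q a → Q (a + p) ∧ f a < f (a + p))
    {a : ℝ} (ha : Q a) (n : ℕ) : Q (a + (n + 1 : ℕ) * p) ∧ f a < f (a + (n + 1 : ℕ) * p) := by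
  induction n with
  | zero => simpa using h a ha
  | succ k ih =>
    have := h _ ih.1
    have e : a + (k + 1 : ℕ) * p + p = a + (k + 1 + 1 : ℕ) * p := by push_cast; ring
    rw [e] at this
    exact ⟨this.1, ih.2.trans this.2⟩

lemma sign_aux {m ω D x : ℝ} (hm : m ≠ 0) (hω : 0 < ω) (hD : 0 < D)
    (h : |x - m / ω * D| ≤ |m| / (2 * ω) * |D|) : 0 < m * x := by
  have h1 : |m * (x - m / ω * D)| ≤ m ^ 2 / (2 * ω) * D := by
    rw [abs_mul, ← sq_abs m]
    rw [abs_of_pos hD] at h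
    calc _ ≤ |m| * (|m| / (2 * ω) * D) := by gcongr
      _ = _ := by ring
  have h2 := (abs_le.1 h1).1
  have h3 : 0 < m ^ 2 / (2 * ω) * D := by positivity
  have h4 : m * x = m * (x - m / ω * D) + 2 * (m ^ 2 / (2 * ω) * D) := by field_simp; ring
  linarith

lemma disp_small (P : PolarData) : ∃ η > 0, η ≤ P.d0 ∧ ∀ μ : ℝ, |μ| < η → ∀ ρ1 ρ2 J : ℝ → ℝ,
    (∀ t, 0 ≤ ρ1 t ∧ ρ1 t < η) → (∀ t, 0 ≤ ρ2 t ∧ ρ2 t < η) →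
    (∀ t, HasDerivAt ρ1 (ρ1 t * P.G μ t (ρ1 t)) t) →
    (∀ t, HasDerivAt ρ2 (ρ2 t * P.G μ t (ρ2 t)) t) →
    (∀ t, HasDerivAt J (P.G μ t (ρ2 t) - P.G μ t (ρ1 t)) t) → ∀ a,
    0 < ρ2 a - ρ1 a → 0 < ρ2 (a + 2 * π) - ρ1 (a + 2 * π) ∧
      |J (a + 2 * π) - J a - P.m / P.ω * (ρ2 a - ρ1 a)| ≤ |P.m| / (2 * P.ω) * |ρ2 a - ρ1 a| := by
  obtain ⟨K, hK, h⟩ := P.disp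
  have hω := P.hω
  have hm := abs_pos.2 P.hm
  have hpi := Real.pi_pos
  have hd := P.d0_pos
  set κ : ℝ := min (1 / 2) (|P.m| / (2 * P.ω)) with hκ
  have hκ0 : 0 < κ := by positivity
  refine ⟨min P.d0 (κ / (2 * K)), by positivity, min_le_left _ _, ?_⟩
  intro μ hμ ρ1 ρ2 J h1 h2 d1 d2 dJ a hD
  have hμ1 : |μ| < P.d0 := hμ.trans_le (min_le_left _ _)
  have hμ2 : |μ| < κ / (2 * K) := hμ.trans_le (min_le_right _ _)
  obtain ⟨q1, q2⟩ := h μ (min P.d0 (κ / (2 * K))) a ρ1 ρ2 J (hμ1.le.trans P.d0_le_one)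
    (min_le_left _ _) (fun t _ => ⟨(h1 t).1, (h1 t).2.le, (h2 t).1, (h2 t).2.le⟩)
    (fun t _ => (d1 t).hasDerivWithinAt) (fun t _ => (d2 t).hasDerivWithinAt)
    (fun t _ => (dJ t).hasDerivWithinAt)
  have hb : K * (min P.d0 (κ / (2 * K)) + |μ|) ≤ κ := by
    calc _ ≤ K * (κ / (2 * K) + κ / (2 * K)) := by
          gcongr; exact min_le_right _ _
      _ = κ := by field_simp; ring
  constructor
  · have q3 := q2 (a + 2 * π) ⟨by linarith, le_rfl⟩
    have : K * (min P.d0 (κ / (2 * K)) + |μ|) ≤ 1 / 2 := hb.trans (min_le_left _ _)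
    have q4 : K * (min P.d0 (κ / (2 * K)) + |μ|) * |ρ2 a - ρ1 a| ≤ 1 / 2 * |ρ2 a - ρ1 a| := by
      gcongr
    rw [abs_of_pos hD] at q3 q4
    have := (abs_le.1 (q3.trans q4)).1
    linarith
  · refine q1.trans ?_
    gcongr
    exact hb.trans (min_le_right _ _)

/-- Uniqueness and nonexistence at the level of the radial equation. -/
lemma uniq_nonex (P : PolarData) : ∃ η > 0, η ≤ P.d0 ∧ ∀ μ : ℝ, |μ| < η →
    (∀ (ρ1 ρ2 : ℝ → ℝ) (n1 n2 : ℕ),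
      (∀ t, 0 < ρ1 t ∧ ρ1 t < η) → (∀ t, 0 < ρ2 t ∧ ρ2 t < η) →
      (∀ t, HasDerivAt ρ1 (ρ1 t * P.G μ t (ρ1 t)) t) →
      (∀ t, HasDerivAt ρ2 (ρ2 t * P.G μ t (ρ2 t)) t) →
      (∀ s, ρ1 (s + (n1 + 1 : ℕ) * (2 * π)) = ρ1 s) →
      (∀ s, ρ2 (s + (n2 + 1 : ℕ) * (2 * π)) = ρ2 s) → ∀ a, ρ2 a ≤ ρ1 a) ∧
    (0 < μ * P.m → ∀ (ρ : ℝ → ℝ) (n : ℕ), (∀ t, 0 < ρ t ∧ ρ t < η) →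
      (∀ t, HasDerivAt ρ (ρ t * P.G μ t (ρ t)) t) →
      (∀ s, ρ (s + (n + 1 : ℕ) * (2 * π)) = ρ s) → False) := by
  obtain ⟨η, hη, hηd, h⟩ := P.disp_small
  have hω := P.hω
  have hpi := Real.pi_pos
  refine ⟨η, hη, hηd, fun μ hμ => ⟨?_, ?_⟩⟩
  · intro ρ1 ρ2 n1 n2 h1 h2 d1 d2 p1 p2 a
    by_contra hcon
    push Not at hcon
    have dl : ∀ ρ : ℝ → ℝ, (∀ t, 0 < ρ t ∧ ρ t < η) →
      (∀ t, HasDerivAt ρ (ρ t * P.G μ t (ρ t)) t) → ∀ t,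
      HasDerivAt (fun t => Real.log (ρ t)) (P.G μ t (ρ t)) t := by
      intro ρ hp hd t
      have := (hd t).log (hp t).1.ne'
      rwa [mul_div_cancel_left₀ _ (hp t).1.ne'] at this
    have g := grow (f := fun t => P.m * (Real.log (ρ2 t) - Real.log (ρ1 t)))
      (Q := fun t => 0 < ρ2 t - ρ1 t) (p := 2 * π) (by
        intro a ha
        obtain ⟨q1, q2⟩ := h μ hμ ρ1 ρ2 (fun t => Real.log (ρ2 t) - Real.log (ρ1 t))
          (fun t => ⟨(h1 t).1.le, (h1 t).2⟩) (fun t => ⟨(h2 t).1.le, (h2 t).2⟩) d1 d2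
          (fun t => (dl ρ2 h2 d2 t).sub (dl ρ1 h1 d1 t)) a ha
        refine ⟨q1, ?_⟩
        have := sign_aux P.hm hω ha q2
        linarith) (sub_pos.2 hcon) ((n1 + 1) * (n2 + 1) - 1)
    have e1 : ρ1 (a + (((n1 + 1) * (n2 + 1) - 1 + 1 : ℕ)) * (2 * π)) = ρ1 a := by
      have := (show Function.Periodic ρ1 ((n1 + 1 : ℕ) * (2 * π)) from p1).nat_mul (n2 + 1) a
      rw [← this]
      congr 2
      rw [Nat.sub_add_cancel (Nat.mul_pos n1.succ_pos n2.succ_pos)]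
      push_cast; ring
    have e2 : ρ2 (a + (((n1 + 1) * (n2 + 1) - 1 + 1 : ℕ)) * (2 * π)) = ρ2 a := by
      have := (show Function.Periodic ρ2 ((n2 + 1 : ℕ) * (2 * π)) from p2).nat_mul (n1 + 1) a
      rw [← this]
      congr 2
      rw [Nat.sub_add_cancel (Nat.mul_pos n1.succ_pos n2.succ_pos)]
      push_cast; ring
    have := g.2
    simp only [e1, e2] at this
    exact lt_irrefl _ this
  · intro hμm ρ n hp hd per
    have g := grow (f := fun t => P.m * (Real.log (ρ t)))
      (Q := fun t => True) (p := 2 * π) (a := 0) (by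
        intro a _
        refine ⟨trivial, ?_⟩
        obtain ⟨-, q2⟩ := h μ hμ (fun _ => 0) ρ (fun t => Real.log (ρ t) - t * (μ / P.ω))
          (fun t => ⟨le_rfl, hη⟩) (fun t => ⟨(hp t).1.le, (hp t).2⟩)
          (fun t => by simpa using hasDerivAt_const t (0:ℝ)) hd
          (fun t => by
            have := ((hd t).log (hp t).1.ne').sub ((hasDerivAt_id t).mul_const (μ / P.ω))
            rw [mul_div_cancel_left₀ _ (hp t).1.ne', one_mul] at this
            rw [P.G_zero]
            exact this) a (by simpa using (hp a).1)
        have := sign_aux P.hm hω (by simpa using (hp a).1) q2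
        have e : P.m * (Real.log (ρ (a + 2 * π)) - (a + 2 * π) * (μ / P.ω) -
          (Real.log (ρ a) - a * (μ / P.ω))) = P.m * Real.log (ρ (a + 2 * π)) - P.m * Real.log (ρ a)
            - 2 * π * (μ * P.m) / P.ω := by ring
        rw [e] at this
        have : 0 < 2 * π * (μ * P.m) / P.ω := by positivity
        linarith) trivial n
    have := g.2
    simp only [per] at this
    exact lt_irrefl _ this

end PolarData

namespace PolarData

lemma G_bound (P : PolarData) {μ θ r : ℝ} (hμ : |μ| ≤ 1) (h0 : 0 ≤ r) (h1 : r ≤ P.d0) :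
    |P.G μ θ r| ≤ (1 + 2 * P.B) / (P.ω / 2) := by
  have h2 := P.rad_bound (θ := θ) hμ h0 h1
  have h3 := P.ang_ge (θ := θ) h0 h1
  have h4 := P.ang_pos (θ := θ) h0 h1
  have hω := P.hω
  have hB := P.hB
  unfold G
  rw [abs_div, abs_of_pos h4]
  gcongr

lemma G_lip (P : PolarData) : ∃ Lc > 0, ∀ μ θ r1 r2 : ℝ, |μ| ≤ 1 → 0 ≤ r1 → r1 ≤ P.d0 →
    0 ≤ r2 → r2 ≤ P.d0 → |P.G μ θ r2 - P.G μ θ r1| ≤ Lc * |r2 - r1| := by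
  obtain ⟨K, hK, hG⟩ := P.G_est
  have hω := P.hω
  have hB := P.hB
  refine ⟨K * 2 + P.B / P.ω, by positivity, ?_⟩
  intro μ θ r1 r2 hμ h1 h1d h2 h2d
  have := hG μ P.d0 θ r1 r2 hμ le_rfl h1 h2 h1d h2d
  have h3 : |P.X2 θ * (r2 - r1) / P.ω| ≤ P.B / P.ω * |r2 - r1| := by
    rw [abs_div, abs_mul, abs_of_pos hω, mul_div_right_comm]
    have := P.bX2 θ
    gcongr
  have h4 : K * (P.d0 + |μ|) * |r2 - r1| ≤ K * 2 * |r2 - r1| := by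
    have := P.d0_le_one
    gcongr; linarith
  have := abs_add_le (P.G μ θ r2 - P.G μ θ r1 - P.X2 θ * (r2 - r1) / P.ω)
    (P.X2 θ * (r2 - r1) / P.ω)
  rw [sub_add_cancel] at this
  linarith

lemma min_exp_lip {d : ℝ} (hd : 0 < d) (hd1 : d ≤ 1) (x y : ℝ) :
    |min (rexp x) d - min (rexp y) d| ≤ |x - y| := by
  wlog h : y ≤ x generalizing x y
  · rw [abs_sub_comm, abs_sub_comm x y]; exact this y x (le_of_not_ge h)
  have e : ∀ x, min (rexp x) d = rexp (min x (Real.log d)) := by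
    intro x
    rw [Real.exp_monotone.map_min, Real.exp_log hd]
  have hm : min y (Real.log d) ≤ min x (Real.log d) := min_le_min_right _ h
  rw [e, e, abs_of_nonneg (sub_nonneg.2 (Real.exp_le_exp.2 hm)), abs_of_nonneg (sub_nonneg.2 h)]
  set x' := min x (Real.log d) with hx'
  set y' := min y (Real.log d) with hy'
  have h1 : rexp x' ≤ 1 := by rw [← e]; exact (min_le_right _ _).trans hd1
  have h2 : x' - y' ≤ x - y := by
    rcases le_total x (Real.log d) with h3 | h3
    · rw [hx', hy', min_eq_left h3, min_eq_left (h.trans h3)]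
    · rw [hx', min_eq_right h3]
      rcases le_total y (Real.log d) with h4 | h4
      · rw [hy', min_eq_left h4]; linarith
      · rw [hy', min_eq_right h4]; linarith
  have h3 : rexp y' = rexp x' * rexp (y' - x') := by rw [← Real.exp_add]; congr 1; ring
  have h4 := Real.add_one_le_exp (y' - x')
  have h5 := Real.exp_pos x'
  rw [h3]
  nlinarith

lemma G_cont (P : PolarData) {μ : ℝ} {r : ℝ → ℝ} (hr : Continuous r)
    (h : ∀ t, 0 ≤ r t ∧ r t ≤ P.d0) : Continuous fun t => P.G μ t (r t) := by
  have := P.cX2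
  have := P.cX3
  have := P.cO2
  have := P.cO3
  unfold G
  refine Continuous.div ?_ ?_ fun t => (P.ang_pos (h t).1 (h t).2).ne'
  · unfold rad; fun_prop
  · unfold ang; fun_prop

lemma G_per (P : PolarData) (μ t r : ℝ) : P.G μ (t + 2 * π) r = P.G μ t r := by
  simp only [G, rad, ang, P.pX2, P.pX3, P.pO2, P.pO3]

lemma glue (P : PolarData) {μ : ℝ} {z : ℝ → ℝ}
    (hz : ∀ t ∈ Icc (0:ℝ) (0 + 2 * π),
      HasDerivWithinAt z (P.G μ t (rexp (z t))) (Icc 0 (0 + 2 * π)) t)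
    (hb : ∀ t ∈ Icc (0:ℝ) (0 + 2 * π), rexp (z t) ≤ P.d0) (hper : z 0 = z (0 + 2 * π)) :
    ∃ Z : ℝ → ℝ, (∀ t, HasDerivAt Z (P.G μ t (rexp (Z t))) t) ∧ (∀ t, Z (t + 2 * π) = Z t) ∧
      ∀ t ∈ Icc (0:ℝ) (0 + 2 * π), Z t = z t := by
  have hpi : 0 < 2 * π := Real.two_pi_pos
  have : Fact (0 < 2 * π) := ⟨hpi⟩
  set zp : ℝ → ℝ := fun t => AddCircle.liftIco (2 * π) 0 z (t : AddCircle (2 * π)) with hzp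
  have czp : Continuous zp :=
    (AddCircle.liftIco_continuous hper (fun t ht => (hz t ht).continuousWithinAt)).comp
      (AddCircle.continuous_mk' _)
  have pzp : Function.Periodic zp (2 * π) := fun t => by
    simp only [hzp, AddCircle.coe_add_period]
  have ezp : ∀ t ∈ Ico (0:ℝ) (0 + 2 * π), zp t = z t := fun t ht =>
    AddCircle.liftIco_coe_apply ht
  have ezp' : ∀ t ∈ Icc (0:ℝ) (0 + 2 * π), zp t = z t := by
    intro t ht
    rcases ht.2.lt_or_eq with h | h
    · exact ezp t ⟨ht.1, h⟩
    · rw [h, pzp 0, ezp 0 ⟨le_rfl, by linarith⟩, hper]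
  have bzp : ∀ t, rexp (zp t) ≤ P.d0 := by
    intro t
    obtain ⟨y, hy, e⟩ := pzp.exists_mem_Ico₀ hpi t
    rw [e, ezp y (by simpa using hy)]
    exact hb y ⟨hy.1, by linarith [hy.2]⟩
  set g : ℝ → ℝ := fun t => P.G μ t (rexp (zp t)) with hg
  have cg : Continuous g := P.G_cont (Real.continuous_exp.comp czp)
    fun t => ⟨(Real.exp_pos _).le, bzp t⟩
  have pg : ∀ t, g (t + 2 * π) = g t := fun t => by
    simp only [hg]; rw [P.G_per, pzp]
  set Z : ℝ → ℝ := fun t => z 0 + ∫ s in (0:ℝ)..t, g s with hZ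
  have dZ : ∀ t, HasDerivAt Z (g t) t := fun t =>
    (cg.integral_hasStrictDerivAt 0 t).hasDerivAt.const_add _
  have Z0 : Z 0 = z 0 := by simp [hZ]
  have eZ : ∀ t ∈ Icc (0:ℝ) (0 + 2 * π), Z t = z t := by
    intro t ht
    have := norm_image_sub_le_of_norm_deriv_le_segment' (f := fun t => Z t - z t) (C := 0)
      (fun t ht => ((dZ t).hasDerivWithinAt).sub (hz t ht))
      (fun t ht => by
        simp only [hg]; rw [ezp t ht]; simp) t ht
    simp only [Z0, sub_self, sub_zero, zero_mul] at this
    have := norm_le_zero_iff.1 this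
    linarith
  have pZ : Function.Periodic Z (2 * π) := by
    have dd : ∀ t, HasDerivAt (fun t => Z (t + 2 * π) - Z t) 0 t := by
      intro t
      have := ((dZ (t + 2 * π)).comp_add_const t (2 * π)).sub (dZ t)
      rwa [pg, sub_self] at this
    intro t
    have := is_const_of_deriv_eq_zero (fun t => (dd t).differentiableAt) (fun t => (dd t).deriv) t 0
    rw [eZ (0 + 2 * π) ⟨by linarith, le_rfl⟩, Z0, ← hper] at this
    linarith
  have eq : ∀ t, Z t = zp t := by
    intro t
    have hp : Function.Periodic (fun t => Z t - zp t) (2 * π) := fun t => by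
      simp only [pZ t, pzp t]
    obtain ⟨y, hy, e⟩ := hp.exists_mem_Ico₀ hpi t
    have hy' : y ∈ Ico (0:ℝ) (0 + 2 * π) := by simpa using hy
    simp only [eZ y (Ico_subset_Icc_self hy'), ezp y hy', sub_self] at e
    linarith
  refine ⟨Z, fun t => ?_, pZ, eZ⟩
  rw [eq t]; exact dZ t

lemma exists_flow (P : PolarData) {μ : ℝ} (hμ : |μ| ≤ 1) (x0 : ℝ) :
    ∃ α : ℝ → ℝ → ℝ, (∀ x ∈ Icc (x0 - Real.log 2) (x0 + Real.log 2), α x 0 = x ∧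
      ∀ t ∈ Icc (0:ℝ) (0 + 2 * π), HasDerivWithinAt (α x)
        (P.G μ t (min (rexp (α x t)) P.d0)) (Icc 0 (0 + 2 * π)) t) ∧
      ContinuousOn (fun x => α x (0 + 2 * π)) (Icc (x0 - Real.log 2) (x0 + Real.log 2)) := by
  obtain ⟨Lc, hLc, hlip⟩ := P.G_lip
  have hpi : 0 < 2 * π := Real.two_pi_pos
  have hω := P.hω
  have hB := P.hB
  have hd := P.d0_pos
  have hl2 : 0 < Real.log 2 := Real.log_pos (by norm_num)
  set M : ℝ := (1 + 2 * P.B) / (P.ω / 2) with hM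
  have hMp : 0 < M := by positivity
  have hmin : ∀ x, 0 ≤ min (rexp x) P.d0 ∧ min (rexp x) P.d0 ≤ P.d0 := fun x =>
    ⟨by positivity, min_le_right _ _⟩
  have pl : IsPicardLindelof (fun t x => P.G μ t (min (rexp x) P.d0))
      (tmin := 0) (tmax := 0 + 2 * π) ⟨0, le_rfl, by linarith⟩ x0
      ⟨M * (2 * π) + Real.log 2, by positivity⟩ ⟨Real.log 2, hl2.le⟩ ⟨M, hMp.le⟩
      ⟨Lc, hLc.le⟩ := by
    refine ⟨?_, ?_, ?_, ?_⟩
    · intro t _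
      refine LipschitzOnWith.of_dist_le_mul fun x _ y _ => ?_
      rw [Real.dist_eq, Real.dist_eq]
      refine (hlip μ t _ _ hμ (hmin y).1 (hmin y).2 (hmin x).1 (hmin x).2).trans ?_
      change Lc * _ ≤ Lc * _
      exact mul_le_mul_of_nonneg_left (min_exp_lip hd P.d0_le_one x y) hLc.le
    · intro x _
      exact (P.G_cont continuous_const fun _ => hmin x).continuousOn
    · intro t _ x _
      exact P.G_bound hμ (hmin x).1 (hmin x).2
    · change M * max (0 + 2 * π - 0) (0 - 0) ≤ M * (2 * π) + Real.log 2 - Real.log 2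
      rw [max_eq_left (by linarith)]
      linarith
  obtain ⟨α, h1, L', h2⟩ := pl.exists_forall_mem_closedBall_eq_hasDerivWithinAt_lipschitzOnWith
  have eb : ∀ x ∈ Icc (x0 - Real.log 2) (x0 + Real.log 2),
      x ∈ Metric.closedBall x0 (Real.log 2) := fun x hx => by
    rw [Real.closedBall_eq_Icc]; exact hx
  exact ⟨α, fun x hx => h1 x (eb x hx),
    (h2 (0 + 2 * π) ⟨by linarith, le_rfl⟩).continuousOn.mono eb⟩

set_option maxHeartbeats 1000000 in
lemma exists_rho (P : PolarData) : ∃ ε > 0, ∃ C > 0, ∀ μ : ℝ, |μ| < ε → μ * P.m < 0 →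
    ∃ ρ : ℝ → ℝ, (∀ t, 0 < ρ t ∧ ρ t ≤ P.d0 ∧ ρ t ≤ C * |μ|) ∧
      (∀ t, HasDerivAt ρ (ρ t * P.G μ t (ρ t)) t) ∧ (∀ t, ρ (t + 2 * π) = ρ t) ∧
      |ρ 0 + 2 * π * μ / P.m| ≤ C * μ ^ 2 ∧ ∀ t, |ρ t - ρ 0| ≤ C * μ ^ 2 := by
  obtain ⟨K, hK, hdisp⟩ := P.disp
  have hpi : 0 < 2 * π := Real.two_pi_pos
  have hω := P.hω
  have hB := P.hB
  have hd := P.d0_pos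
  have hm := abs_pos.2 P.hm
  have hl2 : 0 < Real.log 2 := Real.log_pos (by norm_num)
  set M : ℝ := (1 + 2 * P.B) / (P.ω / 2) with hM
  have hMp : 0 < M := by positivity
  set R : ℝ := 2 * π / |P.m| with hR
  have hRp : 0 < R := by positivity
  set Cd : ℝ := 2 * R * rexp (M * (2 * π)) with hCd
  have hCdp : 0 < Cd := by positivity
  set K' : ℝ := K * (Cd + 1) with hK'
  have hK'p : 0 < K' := by positivity
  refine ⟨min 1 (min (P.d0 / Cd) (|P.m| / P.ω / (2 * K'))), by positivity,
    Cd + K' * (2 * R) + P.ω / |P.m| * (K' * (2 * R)), by positivity, ?_⟩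
  intro μ hμ hμm
  have hμ1 : |μ| ≤ 1 := hμ.le.trans (min_le_left _ _)
  have hμ2 : Cd * |μ| ≤ P.d0 := by
    have := hμ.le.trans ((min_le_right _ _).trans (min_le_left _ _))
    rwa [le_div_iff₀ hCdp, mul_comm] at this
  have hμ3 : 2 * K' * |μ| ≤ |P.m| / P.ω := by
    have := hμ.le.trans ((min_le_right _ _).trans (min_le_right _ _))
    rwa [le_div_iff₀ (by positivity), mul_comm] at this
  have hμ0 : 0 < |μ| := abs_pos.2 (by rintro rfl; simp at hμm)
  set rs : ℝ := R * |μ| with hrs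
  have hrsp : 0 < rs := by positivity
  have hrsm : P.m * rs = - (2 * π * μ) := by
    rcases lt_or_gt_of_ne P.hm with h | h
    · have : 0 < μ := by by_contra hc; push Not at hc; nlinarith
      rw [hrs, hR, abs_of_pos this, abs_of_neg h]; field_simp [h.ne]
    · have : μ < 0 := by by_contra hc; push Not at hc; nlinarith
      rw [hrs, hR, abs_of_neg this, abs_of_pos h]; field_simp [h.ne']
  obtain ⟨α, hα, cα⟩ := P.exists_flow hμ1 (Real.log rs)
  set x1 := Real.log rs - Real.log 2 with hx1
  set x2 := Real.log rs + Real.log 2 with hx2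
  have ex1 : rexp x1 = rs / 2 := by
    rw [hx1, Real.exp_sub, Real.exp_log hrsp, Real.exp_log (by norm_num)]
  have ex2 : rexp x2 = 2 * rs := by
    rw [hx2, Real.exp_add, Real.exp_log hrsp, Real.exp_log (by norm_num)]; ring
  have hmin : ∀ x, 0 ≤ min (rexp x) P.d0 ∧ min (rexp x) P.d0 ≤ P.d0 := fun x =>
    ⟨by positivity, min_le_right _ _⟩
  have small : ∀ x ∈ Icc x1 x2, ∀ t ∈ Icc (0:ℝ) (0 + 2 * π), rexp (α x t) ≤ Cd * |μ| := by
    intro x hx t ht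
    obtain ⟨a0, da⟩ := hα x hx
    have := norm_image_sub_le_of_norm_deriv_le_segment' (C := M) da
      (fun t _ => P.G_bound hμ1 (hmin _).1 (hmin _).2) t ht
    rw [a0, Real.norm_eq_abs] at this
    have h1 := (abs_le.1 this).2
    have h2 : M * (t - 0) ≤ M * (2 * π) := by
      gcongr; linarith [ht.2]
    calc rexp (α x t) ≤ rexp (x2 + M * (2 * π)) := Real.exp_le_exp.2 (by linarith [hx.2])
      _ = Cd * |μ| := by rw [Real.exp_add, ex2, hCd, hrs]; ring
  have da : ∀ x ∈ Icc x1 x2, ∀ t ∈ Icc (0:ℝ) (0 + 2 * π), HasDerivWithinAt (α x)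
        (P.G μ t (rexp (α x t))) (Icc 0 (0 + 2 * π)) t := by
    intro x hx t ht
    have := (hα x hx).2 t ht
    rwa [min_eq_left ((small x hx t ht).trans hμ2)] at this
  have est : ∀ x ∈ Icc x1 x2, |α x (0 + 2 * π) - x - P.m / P.ω * (rexp x - rs)| ≤
      K' * |μ| * rexp x ∧
      ∀ t ∈ Icc (0:ℝ) (0 + 2 * π), |rexp (α x t) - rexp x| ≤ K' * |μ| * rexp x := by
    intro x hx
    obtain ⟨q1, q2⟩ := hdisp μ (Cd * |μ|) 0 (fun _ => 0) (fun t => rexp (α x t))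
      (fun t => α x t - t * (μ / P.ω)) hμ1 hμ2
      (fun t ht => ⟨le_rfl, by positivity, (Real.exp_pos _).le, small x hx t ht⟩)
      (fun t _ => by simpa using hasDerivWithinAt_const t (Icc (0:ℝ) (0 + 2 * π)) (0:ℝ))
      (fun t ht => (da x hx t ht).exp)
      (fun t ht => by
        have := (da x hx t ht).sub (((hasDerivAt_id t).mul_const (μ / P.ω)).hasDerivWithinAt)
        rw [one_mul] at this
        rw [P.G_zero]
        exact this)
    have eK : K * (Cd * |μ| + |μ|) = K' * |μ| := by rw [hK']; ring
    simp only [(hα x hx).1, eK, sub_zero, abs_of_pos (Real.exp_pos _)] at q1 q2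
    refine ⟨?_, q2⟩
    have e : α x (0 + 2 * π) - x - P.m / P.ω * (rexp x - rs) =
      α x (0 + 2 * π) - (0 + 2 * π) * (μ / P.ω) - (x - 0 * (μ / P.ω)) - P.m / P.ω * rexp x := by
      have : P.m / P.ω * rs = - (2 * π) * (μ / P.ω) := by
        rw [div_mul_eq_mul_div, hrsm]; ring
      linear_combination this
    rw [e]; exact q1
  have estm : ∀ x ∈ Icc x1 x2, |P.m * (α x (0 + 2 * π) - x) - P.m ^ 2 / P.ω * (rexp x - rs)| ≤
      P.m ^ 2 / P.ω / 2 * rexp x := by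
    intro x hx
    have e : P.m * (α x (0 + 2 * π) - x) - P.m ^ 2 / P.ω * (rexp x - rs) =
      P.m * (α x (0 + 2 * π) - x - P.m / P.ω * (rexp x - rs)) := by ring
    rw [e, abs_mul]
    have h1 := (est x hx).1
    have h2 : K' * |μ| ≤ |P.m| / P.ω / 2 := by linarith
    calc _ ≤ |P.m| * (|P.m| / P.ω / 2 * rexp x) := by
          gcongr; exact h1.trans (by gcongr)
      _ = _ := by rw [← sq_abs P.m]; ring
  have hx12 : x1 ≤ x2 := by linarith
  have hc : ContinuousOn (fun x => P.m * (α x (0 + 2 * π) - x)) (Icc x1 x2) :=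
    continuousOn_const.mul (cα.sub continuousOn_id)
  have hmω : 0 < P.m ^ 2 / P.ω := by have := P.hm; positivity
  have iv := intermediate_value_Icc hx12 hc
  obtain ⟨x, hx, hx0⟩ : ∃ x ∈ Icc x1 x2, P.m * (α x (0 + 2 * π) - x) = 0 := by
    have : (0:ℝ) ∈ Icc (P.m * (α x1 (0 + 2 * π) - x1)) (P.m * (α x2 (0 + 2 * π) - x2)) := by
      have h1 := (abs_le.1 (estm x1 ⟨le_rfl, hx12⟩)).2
      have h2 := (abs_le.1 (estm x2 ⟨hx12, le_rfl⟩)).1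
      rw [ex1] at h1
      rw [ex2] at h2
      have := mul_pos hmω hrsp
      constructor <;> nlinarith
    obtain ⟨x, hx, e⟩ := iv this
    exact ⟨x, hx, e⟩
  have hxp : α x (0 + 2 * π) = x := by
    rcases mul_eq_zero.1 hx0 with h | h
    · exact absurd h P.hm
    · linarith
  have hexle : rexp x ≤ 2 * rs := by rw [← ex2]; exact Real.exp_le_exp.2 hx.2
  obtain ⟨Z, dZ, pZ, eZ⟩ := P.glue (da x hx) (fun t ht => (small x hx t ht).trans hμ2)
    (by rw [(hα x hx).1, hxp])
  have Z0 : Z 0 = x := by rw [eZ 0 ⟨le_rfl, by linarith⟩, (hα x hx).1]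
  have red : ∀ t, ∃ y ∈ Icc (0:ℝ) (0 + 2 * π), Z t = α x y := by
    intro t
    obtain ⟨y, hy, e⟩ := (show Function.Periodic Z (2 * π) from pZ).exists_mem_Ico₀ hpi t
    have hy' : y ∈ Icc (0:ℝ) (0 + 2 * π) := ⟨hy.1, by linarith [hy.2]⟩
    exact ⟨y, hy', by rw [e, eZ y hy']⟩
  have h2r : K' * |μ| * rexp x ≤ K' * (2 * R) * μ ^ 2 := by
    calc _ ≤ K' * |μ| * (2 * rs) := by gcongr
      _ = _ := by rw [hrs, ← sq_abs μ]; ring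
  have hsq := sq_nonneg μ
  have n1 : 0 ≤ Cd * μ ^ 2 := by positivity
  have n2 : 0 ≤ K' * (2 * R) * μ ^ 2 := by positivity
  have n3 : 0 ≤ P.ω / |P.m| * (K' * (2 * R)) * μ ^ 2 := by positivity
  refine ⟨fun t => rexp (Z t), ?_, ?_, ?_, ?_, ?_⟩
  · intro t
    obtain ⟨y, hy, e⟩ := red t
    have s := small x hx y hy
    simp only [e]
    refine ⟨Real.exp_pos _, s.trans hμ2, s.trans ?_⟩
    gcongr
    have : 0 ≤ K' * (2 * R) := by positivity
    have : 0 ≤ P.ω / |P.m| * (K' * (2 * R)) := by positivity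
    linarith
  · exact fun t => (dZ t).exp
  · intro t; simp only [pZ]
  · have h1 := (est x hx).1
    rw [hxp, sub_self, zero_sub, abs_neg, abs_mul, abs_div, abs_of_pos hω] at h1
    have e : rexp (Z 0) + 2 * π * μ / P.m = rexp x - rs := by
      rw [Z0]
      have := P.hm
      have : rs = - (2 * π * μ) / P.m := by rw [← hrsm]; field_simp
      rw [this]; ring
    simp only [e]
    have h2 : |rexp x - rs| = P.ω / |P.m| * (|P.m| / P.ω * |rexp x - rs|) := by
      field_simp
    rw [h2]
    calc _ ≤ P.ω / |P.m| * (K' * (2 * R) * μ ^ 2) := by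
          exact mul_le_mul_of_nonneg_left (h1.trans h2r) (by positivity)
      _ ≤ _ := by rw [add_mul, add_mul]; linarith
  · intro t
    obtain ⟨y, hy, e⟩ := red t
    simp only [e, Z0]
    refine ((est x hx).2 y hy).trans (h2r.trans ?_)
    rw [add_mul, add_mul]; linarith

end PolarData

namespace PolarData

lemma sol_of_rho (P : PolarData) {μ : ℝ} {F : ℝ × ℝ → ℝ × ℝ} (hF : P.Rep μ F) {ρ : ℝ → ℝ}
    (h0 : ∀ t, 0 < ρ t ∧ ρ t ≤ P.d0) (dρ : ∀ t, HasDerivAt ρ (ρ t * P.G μ t (ρ t)) t)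
    (pρ : ∀ t, ρ (t + 2 * π) = ρ t) :
    ∃ (u : ℝ → ℝ × ℝ) (φ ψ : ℝ → ℝ), IsPeriodicSolution2 F u ∧ (∀ s, φ (ψ s) = s) ∧
      (∀ t, u t = (ρ (φ t) * cos (φ t), ρ (φ t) * sin (φ t))) := by
  have hω := P.hω
  have hpi := Real.pi_pos
  have cρ : Continuous ρ := continuous_iff_continuousAt.2 fun t => (dρ t).continuousAt
  have ap : ∀ t, 0 < P.ang t (ρ t) := fun t => P.ang_pos (h0 t).1.le (h0 t).2
  have ca : Continuous fun t => P.ang t (ρ t) := by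
    have := P.cO2
    have := P.cO3
    unfold ang; fun_prop
  have ci : Continuous fun t => (P.ang t (ρ t))⁻¹ := ca.inv₀ fun t => (ap t).ne'
  set τ : ℝ → ℝ := fun t => ∫ s in (0:ℝ)..t, (P.ang s (ρ s))⁻¹ with hτ
  have dτ : ∀ t, HasDerivAt τ (P.ang t (ρ t))⁻¹ t := fun t =>
    (ci.integral_hasStrictDerivAt 0 t).hasDerivAt
  obtain ⟨φ, i1, i2, dφ⟩ := exists_inverse (c := (P.ω / 2 + P.ω)⁻¹) (by positivity) dτ (by
    intro t
    have := (abs_le.1 (P.ang_near (θ := t) (h0 t).1.le (h0 t).2)).2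
    exact inv_anti₀ (ap t) (by linarith))
  simp only [inv_inv] at dφ
  have τmono : StrictMono τ := strictMono_of_deriv_pos fun t => by
    rw [(dτ t).deriv]; exact inv_pos.2 (ap t)
  have τc : ∀ t, τ (t + 2 * π) - τ t = τ (0 + 2 * π) - τ 0 := by
    have dd : ∀ t, HasDerivAt (fun t => τ (t + 2 * π) - τ t) 0 t := by
      intro t
      have := ((dτ (t + 2 * π)).comp_add_const t (2 * π)).sub (dτ t)
      have e : P.ang (t + 2 * π) (ρ (t + 2 * π)) = P.ang t (ρ t) := by
        simp only [ang, pρ, P.pO2, P.pO3]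
      rwa [e, sub_self] at this
    intro t
    exact is_const_of_deriv_eq_zero (fun t => (dd t).differentiableAt) (fun t => (dd t).deriv) t 0
  have φper : ∀ t, φ (t + (τ (0 + 2 * π) - τ 0)) = φ t + 2 * π := by
    intro t
    apply τmono.injective
    have := τc (φ t)
    rw [i2] at this
    rw [i2]
    linarith
  refine ⟨fun t => (ρ (φ t) * cos (φ t), ρ (φ t) * sin (φ t)), φ, τ, ⟨?_, ?_, ?_⟩, i1, fun t => rfl⟩
  · intro t
    have dr := (dρ (φ t)).comp t (dφ t)
    have d1 := dr.mul (dφ t).cos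
    have d2 := dr.mul (dφ t).sin
    have := d1.prodMk d2
    refine this.congr_deriv ?_
    rw [hF _ _ (h0 _).1.le]
    have hG : P.G μ (φ t) (ρ (φ t)) * P.ang (φ t) (ρ (φ t)) = P.rad μ (φ t) (ρ (φ t)) :=
      div_mul_cancel₀ _ (ap _).ne'
    ext
    · simp only [Function.comp]
      linear_combination ρ (φ t) * cos (φ t) * hG
    · simp only [Function.comp]
      linear_combination ρ (φ t) * sin (φ t) * hG
  · refine ⟨τ (0 + 2 * π) - τ 0, sub_pos.2 (τmono (by linarith)), fun t => ?_⟩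
    simp only [φper, pρ, Real.cos_add_two_pi, Real.sin_add_two_pi]
  · intro hc
    have h1 := (hc (τ 0)).trans (hc (τ π)).symm
    simp only [i1] at h1
    have h2 := congrArg Prod.fst h1
    simp only [Real.cos_zero, Real.cos_pi] at h2
    have := (h0 0).1
    have := (h0 π).1
    linarith

lemma lt_of_ampl {F : ℝ × ℝ → ℝ × ℝ} {u : ℝ → ℝ × ℝ} {δ : ℝ} (hu : IsPeriodicSolution2 F u)
    (h : ampl2 u < δ) : ∀ t, √((u t).1 ^ 2 + (u t).2 ^ 2) < δ := by
  obtain ⟨hs, ⟨T, hT, hp⟩, -⟩ := hu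
  have cu : Continuous u := continuous_iff_continuousAt.2 fun t => (hs t).continuousAt
  have cf : Continuous fun t => √((u t).1 ^ 2 + (u t).2 ^ 2) := by fun_prop
  have pf : Function.Periodic (fun t => √((u t).1 ^ 2 + (u t).2 ^ 2)) T := fun t => by
    simp only [hp]
  have bdd : BddAbove (range fun t => √((u t).1 ^ 2 + (u t).2 ^ 2)) :=
    (pf.compact_of_continuous hT.ne' cf).bddAbove
  exact fun t => (le_ciSup bdd t).trans_lt h

/-- The theorem in abstract polar form. -/
lemma main (P : PolarData) (F : ℝ → ℝ × ℝ → ℝ × ℝ) (hF : ∀ μ, P.Rep μ (F μ))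
    (hFc : ∀ μ, Continuous (F μ)) :
    ∃ ε > 0, ∃ δ > 0, ∃ C > 0, ∀ μ : ℝ, 0 < |μ| → |μ| < ε →
      ((μ * P.m < 0 →
        ∃ u : ℝ → ℝ × ℝ, IsPeriodicSolution2 (F μ) u ∧
          0 < ampl2 u ∧ ampl2 u < δ ∧
          |ampl2 u + 2 * π * μ / P.m| ≤ C * μ ^ 2) ∧
       (∀ u₁ u₂ : ℝ → ℝ × ℝ,
          IsPeriodicSolution2 (F μ) u₁ → IsPeriodicSolution2 (F μ) u₂ →
          ampl2 u₁ < δ → ampl2 u₂ < δ →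
          ∃ s : ℝ, ∀ t, u₂ t = u₁ (t + s)) ∧
       (0 < μ * P.m →
        ¬ ∃ u : ℝ → ℝ × ℝ, IsPeriodicSolution2 (F μ) u ∧ ampl2 u < δ)) := by
  obtain ⟨η, hη, hηd, hun⟩ := P.uniq_nonex
  obtain ⟨ε, hε, C, hC, hex⟩ := P.exists_rho
  refine ⟨min η (min ε (η / (2 * C))), by positivity, η, hη, 2 * C, by positivity, ?_⟩
  intro μ hμ0 hμ
  have hμ1 : |μ| < η := hμ.trans_le (min_le_left _ _)
  have hμ2 : |μ| < ε := hμ.trans_le ((min_le_right _ _).trans (min_le_left _ _))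
  have hμ3 : |μ| < η / (2 * C) := hμ.trans_le ((min_le_right _ _).trans (min_le_right _ _))
  have hμ4 : |μ| ≤ 1 := hμ1.le.trans (hηd.trans P.d0_le_one)
  rw [lt_div_iff₀ (by positivity)] at hμ3
  obtain ⟨hu, hne⟩ := hun μ hμ1
  refine ⟨?_, ?_, ?_⟩
  · intro hs
    obtain ⟨ρ, b, dρ, pρ, e1, e2⟩ := hex μ hμ2 hs
    obtain ⟨u, φ, ψ, hper, i2, hup⟩ := P.sol_of_rho (hF μ) (fun t => ⟨(b t).1, (b t).2.1⟩) dρ pρ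
    have hn : ∀ t, √((u t).1 ^ 2 + (u t).2 ^ 2) = ρ (φ t) := by
      intro t
      rw [hup t]
      have sc := Real.sin_sq_add_cos_sq (φ t)
      have : (ρ (φ t) * cos (φ t)) ^ 2 + (ρ (φ t) * sin (φ t)) ^ 2 = ρ (φ t) ^ 2 := by
        linear_combination ρ (φ t) ^ 2 * sc
      simp only [this]
      exact Real.sqrt_sq (b _).1.le
    have ha : ampl2 u = ⨆ t, ρ (φ t) := by
      unfold ampl2; simp only [hn]
    have bdd : BddAbove (range fun t => ρ (φ t)) := by
      refine ⟨C * |μ|, ?_⟩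
      rintro _ ⟨t, rfl⟩
      exact (b _).2.2
    have l1 : ρ 0 ≤ ampl2 u := by
      rw [ha]
      have := le_ciSup bdd (ψ 0)
      simpa only [i2] using this
    have l2 : ampl2 u ≤ C * |μ| := by
      rw [ha]; exact ciSup_le fun t => (b _).2.2
    have l3 : ampl2 u ≤ ρ 0 + C * μ ^ 2 := by
      rw [ha]; refine ciSup_le fun t => ?_
      have := (abs_le.1 (e2 (φ t))).2
      linarith
    refine ⟨u, hper, (b 0).1.trans_le l1, ?_, ?_⟩
    · have : 0 < C * |μ| := by positivity
      linarith
    · have := abs_le.1 e1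
      rw [abs_le]
      have : 0 ≤ C * μ ^ 2 := by positivity
      constructor <;> linarith
  · intro u1 u2 h1 h2 a1 a2
    have s1 := lt_of_ampl h1 a1
    have s2 := lt_of_ampl h2 a2
    obtain ⟨hs1, ⟨T1, hT1, hp1⟩, hc1⟩ := h1
    obtain ⟨hs2, ⟨T2, hT2, hp2⟩, hc2⟩ := h2
    obtain ⟨φ1, ψ1, ρ1, n1, i1, j1, r1, b1, d1, t1, p1⟩ :=
      P.polar_of_sol hμ4 (hF μ) (hFc μ) hηd hs1 hT1 hp1 hc1 s1
    obtain ⟨φ2, ψ2, ρ2, n2, i2, j2, r2, b2, d2, t2, p2⟩ :=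
      P.polar_of_sol hμ4 (hF μ) (hFc μ) hηd hs2 hT2 hp2 hc2 s2
    have e : ρ2 = ρ1 := funext fun a => le_antisymm
      (hu ρ1 ρ2 n1 n2 b1 b2 d1 d2 p1 p2 a) (hu ρ2 ρ1 n2 n1 b2 b1 d2 d1 p2 p1 a)
    subst e
    have dd : ∀ t, HasDerivAt (fun t => ψ1 t - ψ2 t) 0 t := by
      intro t
      have := (t1 t).sub (t2 t)
      rwa [sub_self] at this
    have hc : ∀ t, ψ1 t - ψ2 t = ψ1 0 - ψ2 0 := fun t =>
      is_const_of_deriv_eq_zero (fun t => (dd t).differentiableAt) (fun t => (dd t).deriv) t 0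
    refine ⟨ψ1 0 - ψ2 0, fun t => ?_⟩
    have : φ1 (t + (ψ1 0 - ψ2 0)) = φ2 t := by
      have := hc (φ2 t)
      rw [i2] at this
      rw [← this]
      have e : t + (ψ1 (φ2 t) - t) = ψ1 (φ2 t) := by ring
      rw [e, j1]
    rw [r2, r1, this]
  · rintro hs ⟨u, h1, a1⟩
    have s1 := lt_of_ampl h1 a1
    obtain ⟨hs1, ⟨T1, hT1, hp1⟩, hc1⟩ := h1
    obtain ⟨φ1, ψ1, ρ1, n1, i1, j1, r1, b1, d1, t1, p1⟩ :=
      P.polar_of_sol hμ4 (hF μ) (hFc μ) hηd hs1 hT1 hp1 hc1 s1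
    exact hne hs ρ1 n1 b1 d1 p1

end PolarData

namespace PolarData

/-- integral over one quadrant of a function that is a trigonometric cubic there -/
lemma quad_integral {f : ℝ → ℝ} {a b : ℝ} (hab : a ≤ b) (A B C D : ℝ)
    (h : ∀ θ, a ≤ θ → θ ≤ b → f θ =
      A * cos θ ^ 3 + B * (cos θ ^ 2 * sin θ) + C * (sin θ ^ 2 * cos θ) + D * sin θ ^ 3) :
    ∫ θ in a..b, f θ =
      (A * (sin b - sin b ^ 3 / 3) - B * cos b ^ 3 / 3 + C * sin b ^ 3 / 3
        + D * (-cos b + cos b ^ 3 / 3)) -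
      (A * (sin a - sin a ^ 3 / 3) - B * cos a ^ 3 / 3 + C * sin a ^ 3 / 3
        + D * (-cos a + cos a ^ 3 / 3)) := by
  rw [intervalIntegral.integral_congr (g := fun θ => A * cos θ ^ 3 + B * (cos θ ^ 2 * sin θ)
    + C * (sin θ ^ 2 * cos θ) + D * sin θ ^ 3)]
  · apply intervalIntegral.integral_eq_sub_of_hasDerivAt
      (f := fun b => A * (sin b - sin b ^ 3 / 3) - B * cos b ^ 3 / 3 + C * sin b ^ 3 / 3
        + D * (-cos b + cos b ^ 3 / 3))
    · intro x _
      have hs := Real.hasDerivAt_sin x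
      have hc := Real.hasDerivAt_cos x
      have e := Real.sin_sq_add_cos_sq x
      have := (((((hs.sub ((hs.pow 3).div_const 3)).const_mul A).sub
        (((hc.pow 3).const_mul B).div_const 3)).add
        (((hs.pow 3).const_mul C).div_const 3)).add
        ((hc.neg.add ((hc.pow 3).div_const 3)).const_mul D))
      refine this.congr_deriv ?_
      push_cast
      linear_combination (-A * cos x - D * sin x) * e
    · apply Continuous.intervalIntegrable
      fun_prop
  · intro θ hθ
    rw [uIcc_of_le hab] at hθ
    exact h θ hθ.1 hθ.2

lemma total_integral (a11 a12 a21 a22 b11 b12 b21 b22 a1 a2 a3 b1 b2 b3 : ℝ) (f : ℝ → ℝ)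
    (hf : ∀ θ, f θ = cos θ * (a11 * cos θ * |cos θ| + a12 * cos θ * |sin θ| + a21 * sin θ * |cos θ|
        + a22 * sin θ * |sin θ| + (a1 * cos θ ^ 2 + a2 * cos θ * sin θ + a3 * sin θ ^ 2)) +
      sin θ * (b11 * cos θ * |cos θ| + b12 * cos θ * |sin θ| + b21 * sin θ * |cos θ|
        + b22 * sin θ * |sin θ| + (b1 * cos θ ^ 2 + b2 * cos θ * sin θ + b3 * sin θ ^ 2))) :
    ∫ θ in (0:ℝ)..(2 * π), f θ = 4 * (2 * a11 + a12 + b21 + 2 * b22) / 3 := by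
  have hpi := Real.pi_pos
  have cf : Continuous f := by
    have : f = _ := funext hf
    rw [this]; fun_prop
  have ii : ∀ a b : ℝ, IntervalIntegrable f MeasureTheory.volume a b :=
    fun a b => cf.intervalIntegrable a b
  rw [← intervalIntegral.integral_add_adjacent_intervals (ii 0 (π / 2)) (ii (π / 2) (2 * π)),
    ← intervalIntegral.integral_add_adjacent_intervals (ii (π / 2) π) (ii π (2 * π)),
    ← intervalIntegral.integral_add_adjacent_intervals (ii π (π + π / 2)) (ii (π + π / 2) (2 * π))]
  have s3 : sin (π + π / 2) = -1 := by rw [add_comm, Real.sin_add_pi, Real.sin_pi_div_two]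
  have c3 : cos (π + π / 2) = 0 := by rw [add_comm, Real.cos_add_pi, Real.cos_pi_div_two, neg_zero]
  have sneg : ∀ θ, π ≤ θ → θ ≤ 2 * π → sin θ ≤ 0 := by
    intro θ h1 h2
    have := Real.sin_nonneg_of_nonneg_of_le_pi (x := θ - π) (by linarith) (by linarith)
    rw [Real.sin_sub_pi] at this
    linarith
  have cpos : ∀ θ, π + π / 2 ≤ θ → θ ≤ 2 * π → 0 ≤ cos θ := by
    intro θ h1 h2
    rw [← Real.cos_sub_two_pi]
    exact Real.cos_nonneg_of_neg_pi_div_two_le_of_le (by linarith) (by linarith)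
  rw [quad_integral (by linarith) (a11 + a1) (a12 + a21 + a2 + b11 + b1)
      (a22 + a3 + b12 + b21 + b2) (b22 + b3) ?_,
    quad_integral (by linarith) (-a11 + a1) (a12 - a21 + a2 - b11 + b1)
      (a22 + a3 + b12 - b21 + b2) (b22 + b3) ?_,
    quad_integral (by linarith) (-a11 + a1) (-a12 - a21 + a2 - b11 + b1)
      (-a22 + a3 - b12 - b21 + b2) (-b22 + b3) ?_,
    quad_integral (by linarith) (a11 + a1) (-a12 + a21 + a2 + b11 + b1)
      (-a22 + a3 - b12 + b21 + b2) (-b22 + b3) ?_]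
  · simp only [s3, c3, Real.sin_zero, Real.cos_zero, Real.sin_pi, Real.cos_pi,
      Real.sin_pi_div_two, Real.cos_pi_div_two, Real.sin_two_pi, Real.cos_two_pi]
    ring
  · intro θ h1 h2
    rw [hf, abs_of_nonneg (cpos θ h1 h2), abs_of_nonpos (sneg θ (by linarith) h2)]
    ring
  · intro θ h1 h2
    rw [hf, abs_of_nonpos (Real.cos_nonpos_of_pi_div_two_le_of_le (by linarith) h2),
      abs_of_nonpos (sneg θ h1 (by linarith))]
    ring
  · intro θ h1 h2
    rw [hf, abs_of_nonpos (Real.cos_nonpos_of_pi_div_two_le_of_le h1 (by linarith)),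
      abs_of_nonneg (Real.sin_nonneg_of_nonneg_of_le_pi (by linarith) h2)]
    ring
  · intro θ h1 h2
    rw [hf, abs_of_nonneg (Real.cos_nonneg_of_neg_pi_div_two_le_of_le (by linarith) h2),
      abs_of_nonneg (Real.sin_nonneg_of_nonneg_of_le_pi h1 (by linarith))]
    ring

lemma periodic_bound {f : ℝ → ℝ} (cf : Continuous f) (pf : ∀ θ, f (θ + 2 * π) = f θ) :
    ∃ B, ∀ θ, |f θ| ≤ B := by
  have hp : Function.Periodic f (2 * π) := pf
  have := Real.pi_pos
  obtain ⟨B, hB⟩ := (isCompact_Icc (a := (0:ℝ)) (b := 2 * π)).exists_bound_of_continuousOn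
    cf.continuousOn
  refine ⟨B, fun θ => ?_⟩
  obtain ⟨y, hy, e⟩ := hp.exists_mem_Ico₀ (by positivity) θ
  rw [e]
  exact hB y ⟨hy.1, hy.2.le⟩

/-- a datum from continuous periodic coefficient functions -/
lemma exists_data {ω m : ℝ} (hω : 0 < ω) (hm : m ≠ 0) {X2 X3 O2 O3 : ℝ → ℝ}
    (cX2 : Continuous X2) (cX3 : Continuous X3) (cO2 : Continuous O2) (cO3 : Continuous O3)
    (pX2 : ∀ θ, X2 (θ + 2 * π) = X2 θ) (pX3 : ∀ θ, X3 (θ + 2 * π) = X3 θ)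
    (pO2 : ∀ θ, O2 (θ + 2 * π) = O2 θ) (pO3 : ∀ θ, O3 (θ + 2 * π) = O3 θ)
    (hInt : ∫ θ in (0:ℝ)..(2 * π), X2 θ = m) :
    ∃ P : PolarData, P.ω = ω ∧ P.m = m ∧ P.X2 = X2 ∧ P.X3 = X3 ∧ P.O2 = O2 ∧ P.O3 = O3 := by
  obtain ⟨B1, h1⟩ := periodic_bound cX2 pX2
  obtain ⟨B2, h2⟩ := periodic_bound cX3 pX3
  obtain ⟨B3, h3⟩ := periodic_bound cO2 pO2
  obtain ⟨B4, h4⟩ := periodic_bound cO3 pO3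
  have n1 := (abs_nonneg _).trans (h1 0)
  have n2 := (abs_nonneg _).trans (h2 0)
  have n3 := (abs_nonneg _).trans (h3 0)
  have n4 := (abs_nonneg _).trans (h4 0)
  refine ⟨{ ω := ω, m := m, B := 1 + B1 + B2 + B3 + B4, X2 := X2, X3 := X3, O2 := O2, O3 := O3,
            Xi := fun t => ∫ s in (0:ℝ)..t, X2 s, hω := hω, hm := hm, hB := by linarith,
            cX2 := cX2, cX3 := cX3, cO2 := cO2, cO3 := cO3,
            bX2 := fun θ => by linarith [h1 θ], bX3 := fun θ => by linarith [h2 θ],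
            bO2 := fun θ => by linarith [h3 θ], bO3 := fun θ => by linarith [h4 θ],
            pX2 := pX2, pX3 := pX3, pO2 := pO2, pO3 := pO3,
            dXi := fun t => (cX2.integral_hasStrictDerivAt 0 t).hasDerivAt,
            pXi := fun t => ?_ }, rfl, rfl, rfl, rfl, rfl, rfl⟩
  have hp : Function.Periodic X2 (2 * π) := pX2
  have e := hp.intervalIntegral_add_eq t 0
  rw [zero_add, hInt] at e
  rw [← intervalIntegral.integral_add_adjacent_intervals (cX2.intervalIntegrable 0 t)
    (cX2.intervalIntegrable t _), e]

end PolarData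

lemma stmt5_pos (ω : ℝ) (hω : 0 < ω)
    (a11 a12 a21 a22 b11 b12 b21 b22 a1 a2 a3 b1 b2 b3 : ℝ)
    (ca1 ca2 ca3 ca4 cb1 cb2 cb3 cb4 : ℝ)
    (σ : ℝ) (hσdef : σ = 2 * a11 + a12 + b21 + 2 * b22) (hσ : σ ≠ 0)
    (F : ℝ → ℝ × ℝ → ℝ × ℝ)
    (hF : ∀ μ p, F μ p =
      (μ * p.1 - ω * p.2 +
        (a11 * p.1 * |p.1| + a12 * p.1 * |p.2| + a21 * p.2 * |p.1| + a22 * p.2 * |p.2|) +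
        (a1 * p.1 ^ 2 + a2 * p.1 * p.2 + a3 * p.2 ^ 2) +
        (ca1 * p.1 ^ 3 + ca2 * p.1 * p.2 ^ 2 + ca3 * p.1 ^ 2 * p.2 + ca4 * p.2 ^ 3),
       ω * p.1 + μ * p.2 +
        (b11 * p.1 * |p.1| + b12 * p.1 * |p.2| + b21 * p.2 * |p.1| + b22 * p.2 * |p.2|) +
        (b1 * p.1 ^ 2 + b2 * p.1 * p.2 + b3 * p.2 ^ 2) +
        (cb1 * p.1 ^ 3 + cb2 * p.1 * p.2 ^ 2 + cb3 * p.1 ^ 2 * p.2 + cb4 * p.2 ^ 3))) :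
    ∃ ε > 0, ∃ δ > 0, ∃ C > 0, ∀ μ : ℝ, 0 < |μ| → |μ| < ε →
      ((μ * σ < 0 →
        ∃ u : ℝ → ℝ × ℝ, IsPeriodicSolution2 (F μ) u ∧
          0 < ampl2 u ∧ ampl2 u < δ ∧
          |ampl2 u + 3 * π * μ / (2 * σ)| ≤ C * μ ^ 2) ∧
       (∀ u₁ u₂ : ℝ → ℝ × ℝ,
          IsPeriodicSolution2 (F μ) u₁ → IsPeriodicSolution2 (F μ) u₂ →
          ampl2 u₁ < δ → ampl2 u₂ < δ →
          ∃ s : ℝ, ∀ t, u₂ t = u₁ (t + s)) ∧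
       (0 < μ * σ →
        ¬ ∃ u : ℝ → ℝ × ℝ, IsPeriodicSolution2 (F μ) u ∧ ampl2 u < δ)) := by
  obtain ⟨P2, hP2⟩ : ∃ f : ℝ → ℝ, f = fun θ => (a11 * cos θ * |cos θ| + a12 * cos θ * |sin θ|
    + a21 * sin θ * |cos θ| + a22 * sin θ * |sin θ|
    + (a1 * cos θ ^ 2 + a2 * cos θ * sin θ + a3 * sin θ ^ 2)) := ⟨_, rfl⟩
  obtain ⟨Q2, hQ2⟩ : ∃ f : ℝ → ℝ, f = fun θ => (b11 * cos θ * |cos θ| + b12 * cos θ * |sin θ|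
    + b21 * sin θ * |cos θ| + b22 * sin θ * |sin θ|
    + (b1 * cos θ ^ 2 + b2 * cos θ * sin θ + b3 * sin θ ^ 2)) := ⟨_, rfl⟩
  obtain ⟨P3, hP3⟩ : ∃ f : ℝ → ℝ, f = fun θ => (ca1 * cos θ ^ 3 + ca2 * cos θ * sin θ ^ 2
    + ca3 * cos θ ^ 2 * sin θ + ca4 * sin θ ^ 3) := ⟨_, rfl⟩
  obtain ⟨Q3, hQ3⟩ : ∃ f : ℝ → ℝ, f = fun θ => (cb1 * cos θ ^ 3 + cb2 * cos θ * sin θ ^ 2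
    + cb3 * cos θ ^ 2 * sin θ + cb4 * sin θ ^ 3) := ⟨_, rfl⟩
  have cP2 : Continuous P2 := by rw [hP2]; fun_prop
  have cQ2 : Continuous Q2 := by rw [hQ2]; fun_prop
  have cP3 : Continuous P3 := by rw [hP3]; fun_prop
  have cQ3 : Continuous Q3 := by rw [hQ3]; fun_prop
  have pP2 : ∀ θ, P2 (θ + 2 * π) = P2 θ := by
    intro θ; simp only [hP2, Real.cos_add_two_pi, Real.sin_add_two_pi]
  have pQ2 : ∀ θ, Q2 (θ + 2 * π) = Q2 θ := by
    intro θ; simp only [hQ2, Real.cos_add_two_pi, Real.sin_add_two_pi]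
  have pP3 : ∀ θ, P3 (θ + 2 * π) = P3 θ := by
    intro θ; simp only [hP3, Real.cos_add_two_pi, Real.sin_add_two_pi]
  have pQ3 : ∀ θ, Q3 (θ + 2 * π) = Q3 θ := by
    intro θ; simp only [hQ3, Real.cos_add_two_pi, Real.sin_add_two_pi]
  obtain ⟨P, eω, em, eX2, eX3, eO2, eO3⟩ := PolarData.exists_data (ω := ω) (m := 4 * σ / 3)
    (X2 := fun θ => cos θ * P2 θ + sin θ * Q2 θ) (X3 := fun θ => cos θ * P3 θ + sin θ * Q3 θ)
    (O2 := fun θ => cos θ * Q2 θ - sin θ * P2 θ) (O3 := fun θ => cos θ * Q3 θ - sin θ * P3 θ)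
    hω (by positivity) (by fun_prop) (by fun_prop) (by fun_prop) (by fun_prop)
    (by intro θ; simp only [pP2, pQ2, Real.cos_add_two_pi, Real.sin_add_two_pi])
    (by intro θ; simp only [pP3, pQ3, Real.cos_add_two_pi, Real.sin_add_two_pi])
    (by intro θ; simp only [pP2, pQ2, Real.cos_add_two_pi, Real.sin_add_two_pi])
    (by intro θ; simp only [pP3, pQ3, Real.cos_add_two_pi, Real.sin_add_two_pi])
    (by
      rw [hσdef]
      exact PolarData.total_integral a11 a12 a21 a22 b11 b12 b21 b22 a1 a2 a3 b1 b2 b3 _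
        (fun θ => by simp only [hP2, hQ2]))
  have hrep : ∀ μ, P.Rep μ (F μ) := by
    intro μ r θ hr
    have e := Real.sin_sq_add_cos_sq θ
    have k1 : r * (r * (P2 θ)) = a11 * (r * cos θ) * |r * cos θ| + a12 * (r * cos θ) * |r * sin θ|
        + a21 * (r * sin θ) * |r * cos θ| + a22 * (r * sin θ) * |r * sin θ| +
        (a1 * (r * cos θ) ^ 2 + a2 * (r * cos θ) * (r * sin θ) + a3 * (r * sin θ) ^ 2) := by
      rw [abs_mul, abs_mul, abs_of_nonneg hr, hP2]; ring
    have k2 : r * (r * (Q2 θ)) = b11 * (r * cos θ) * |r * cos θ| + b12 * (r * cos θ) * |r * sin θ|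
        + b21 * (r * sin θ) * |r * cos θ| + b22 * (r * sin θ) * |r * sin θ| +
        (b1 * (r * cos θ) ^ 2 + b2 * (r * cos θ) * (r * sin θ) + b3 * (r * sin θ) ^ 2) := by
      rw [abs_mul, abs_mul, abs_of_nonneg hr, hQ2]; ring
    have k3 : r ^ 3 * P3 θ = ca1 * (r * cos θ) ^ 3 + ca2 * (r * cos θ) * (r * sin θ) ^ 2
        + ca3 * (r * cos θ) ^ 2 * (r * sin θ) + ca4 * (r * sin θ) ^ 3 := by
      rw [hP3]; ring
    have k4 : r ^ 3 * Q3 θ = cb1 * (r * cos θ) ^ 3 + cb2 * (r * cos θ) * (r * sin θ) ^ 2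
        + cb3 * (r * cos θ) ^ 2 * (r * sin θ) + cb4 * (r * sin θ) ^ 3 := by
      rw [hQ3]; ring
    rw [hF]
    simp only [PolarData.rad, PolarData.ang, eω, eX2, eX3, eO2, eO3]
    ext
    · simp only
      linear_combination (-1) * k1 - k3 - (r ^ 2 * P2 θ + r ^ 3 * P3 θ) * e
    · simp only
      linear_combination (-1) * k2 - k4 - (r ^ 2 * Q2 θ + r ^ 3 * Q3 θ) * e
  have hcont : ∀ μ, Continuous (F μ) := by
    intro μ
    have : F μ = _ := funext (hF μ)
    rw [this]; fun_prop
  have key := P.main F hrep hcont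
  rw [em] at key
  have e1 : ∀ μ : ℝ, 2 * π * μ / (4 * σ / 3) = 3 * π * μ / (2 * σ) := by
    intro μ; field_simp; ring
  have e2 : ∀ μ : ℝ, μ * (4 * σ / 3) < 0 ↔ μ * σ < 0 := by
    intro μ; constructor <;> intro h <;> linarith
  have e3 : ∀ μ : ℝ, 0 < μ * (4 * σ / 3) ↔ 0 < μ * σ := by
    intro μ; constructor <;> intro h <;> linarith
  simp only [e1, e2, e3] at key
  exact key

/-- reflection in the first axis carries periodic solutions to periodic solutions -/
lemma refl_periodic {F F' : ℝ × ℝ → ℝ × ℝ}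
    (h : ∀ p : ℝ × ℝ, F' (p.1, -p.2) = ((F p).1, -(F p).2)) {u : ℝ → ℝ × ℝ}
    (hu : IsPeriodicSolution2 F u) : IsPeriodicSolution2 F' (fun t => ((u t).1, -(u t).2)) := by
  obtain ⟨h1, ⟨T, hT, h2⟩, h3⟩ := hu
  refine ⟨fun t => ?_, ⟨T, hT, fun t => by simp only [h2]⟩, fun hc => h3 fun t => ?_⟩
  · rw [h]
    have d1 : HasDerivAt (fun t => (u t).1) (F (u t)).1 t :=
      (hasFDerivAt_fst (𝕜 := ℝ) (p := u t)).comp_hasDerivAt t (h1 t)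
    have d2 : HasDerivAt (fun t => (u t).2) (F (u t)).2 t :=
      (hasFDerivAt_snd (𝕜 := ℝ) (p := u t)).comp_hasDerivAt t (h1 t)
    exact d1.prodMk d2.neg
  · have := hc t
    simp only [Prod.mk.injEq, neg_inj] at this
    exact Prod.ext this.1 this.2

lemma refl_ampl (u : ℝ → ℝ × ℝ) : ampl2 (fun t => ((u t).1, -(u t).2)) = ampl2 u := by
  simp only [ampl2, neg_sq]

/-- Degenerate Hopf bifurcation for the planar system (P') including, besides
the second-order modulus terms `f, g`, smooth quadratic terms `f_q, g_q` and cubic terms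
`f_c, g_c`: if `σ_# = 2a₁₁ + a₁₂ + b₂₁ + 2b₂₂ ≠ 0`, then for small `μ ≠ 0` with `μσ_# < 0`
there is a nonconstant periodic solution of amplitude `−3πμ/(2σ_#) + O(μ²)`, unique up to
time translation among small periodic solutions, and for `μσ_# > 0` there is none; the
smooth terms do not affect `σ_#` or the leading-order bifurcation. -/
theorem stmt5 (ω : ℝ) (hω : ω ≠ 0)
    (a11 a12 a21 a22 b11 b12 b21 b22 a1 a2 a3 b1 b2 b3 : ℝ)
    (ca1 ca2 ca3 ca4 cb1 cb2 cb3 cb4 : ℝ)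
    (σ : ℝ) (hσdef : σ = 2 * a11 + a12 + b21 + 2 * b22) (hσ : σ ≠ 0)
    (F : ℝ → ℝ × ℝ → ℝ × ℝ)
    (hF : ∀ μ p, F μ p =
      (μ * p.1 - ω * p.2 +
        (a11 * p.1 * |p.1| + a12 * p.1 * |p.2| + a21 * p.2 * |p.1| + a22 * p.2 * |p.2|) +
        (a1 * p.1 ^ 2 + a2 * p.1 * p.2 + a3 * p.2 ^ 2) +
        (ca1 * p.1 ^ 3 + ca2 * p.1 * p.2 ^ 2 + ca3 * p.1 ^ 2 * p.2 + ca4 * p.2 ^ 3),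
       ω * p.1 + μ * p.2 +
        (b11 * p.1 * |p.1| + b12 * p.1 * |p.2| + b21 * p.2 * |p.1| + b22 * p.2 * |p.2|) +
        (b1 * p.1 ^ 2 + b2 * p.1 * p.2 + b3 * p.2 ^ 2) +
        (cb1 * p.1 ^ 3 + cb2 * p.1 * p.2 ^ 2 + cb3 * p.1 ^ 2 * p.2 + cb4 * p.2 ^ 3))) :
    ∃ ε > 0, ∃ δ > 0, ∃ C > 0, ∀ μ : ℝ, 0 < |μ| → |μ| < ε →
      ((μ * σ < 0 →
        ∃ u : ℝ → ℝ × ℝ, IsPeriodicSolution2 (F μ) u ∧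
          0 < ampl2 u ∧ ampl2 u < δ ∧
          |ampl2 u + 3 * π * μ / (2 * σ)| ≤ C * μ ^ 2) ∧
       (∀ u₁ u₂ : ℝ → ℝ × ℝ,
          IsPeriodicSolution2 (F μ) u₁ → IsPeriodicSolution2 (F μ) u₂ →
          ampl2 u₁ < δ → ampl2 u₂ < δ →
          ∃ s : ℝ, ∀ t, u₂ t = u₁ (t + s)) ∧
       (0 < μ * σ →
        ¬ ∃ u : ℝ → ℝ × ℝ, IsPeriodicSolution2 (F μ) u ∧ ampl2 u < δ)) := by
  rcases lt_or_gt_of_ne hω with hneg | hpos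
  swap
  · exact stmt5_pos ω hpos a11 a12 a21 a22 b11 b12 b21 b22 a1 a2 a3 b1 b2 b3
      ca1 ca2 ca3 ca4 cb1 cb2 cb3 cb4 σ hσdef hσ F hF
  obtain ⟨F', hF'⟩ : ∃ F' : ℝ → ℝ × ℝ → ℝ × ℝ,
      F' = fun μ p => ((F μ (p.1, -p.2)).1, -(F μ (p.1, -p.2)).2) := ⟨_, rfl⟩
  have r1 : ∀ μ p, F' μ (p.1, -p.2) = ((F μ p).1, -(F μ p).2) := by
    intro μ p; simp only [hF', neg_neg]
  have r2 : ∀ μ p, F μ (p.1, -p.2) = ((F' μ p).1, -(F' μ p).2) := by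
    intro μ p; simp only [hF', neg_neg]
  obtain ⟨ε, hε, δ, hδ, C, hC, key⟩ := stmt5_pos (-ω) (neg_pos.2 hneg)
    a11 a12 (-a21) (-a22) (-b11) (-b12) b21 b22 a1 (-a2) a3 (-b1) b2 (-b3)
    ca1 ca2 (-ca3) (-ca4) (-cb1) (-cb2) cb3 cb4 σ hσdef hσ F' (by
      intro μ p
      simp only [hF', hF, abs_neg]
      ext
      · simp only; ring
      · simp only; ring)
  refine ⟨ε, hε, δ, hδ, C, hC, fun μ h0 h1 => ?_⟩
  obtain ⟨k1, k2, k3⟩ := key μ h0 h1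
  refine ⟨fun hs => ?_, fun u₁ u₂ p1 p2 l1 l2 => ?_, fun hs hc => ?_⟩
  · obtain ⟨u, hu, hr⟩ := k1 hs
    refine ⟨_, refl_periodic (r2 μ) hu, ?_⟩
    rw [refl_ampl]
    exact hr
  · obtain ⟨s, hs⟩ := k2 _ _ (refl_periodic (r1 μ) p1) (refl_periodic (r1 μ) p2)
      (by rwa [refl_ampl]) (by rwa [refl_ampl])
    refine ⟨s, fun t => ?_⟩
    have := hs t
    simp only [Prod.mk.injEq, neg_inj] at this
    exact Prod.ext this.1 this.2
  · obtain ⟨u, hu, hl⟩ := hc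
    exact k3 hs ⟨_, refl_periodic (r1 μ) hu, by rwa [refl_ampl]⟩
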